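/- If a primitive AVRC is reversely strongly degraded, then its random code capacity equals min over pmfs q on S of max over pmfs p on X of I_q(X;Y). -/

import Mathlib

open scoped BigOperators ENNReal

noncomputable section

/-- `p` is a probability mass function on a finite type. -/
def IsPMF {α : Type} [Fintype α] (p : α → ℝ) : Prop :=
  (∀ a, 0 ≤ p a) ∧ ∑ a, p a = 1

/-- `W` is a channel: each `W x s` is a pmf on the output alphabet. -/
def IsChannel {𝒳 𝒮 𝒵 : Type} [Fintype 𝒵] (W : 𝒳 → 𝒮 → 𝒵 → ℝ) : Prop :=
  ∀ x s, IsPMF (W x s)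

/-- Shannon entropy (base 2). By the convention `log₂ 0 = 0` in Mathlib, terms with
`p a = 0` contribute `0`. -/
def ent {α : Type} [Fintype α] (p : α → ℝ) : ℝ :=
  -∑ a, p a * Real.logb 2 (p a)

/-- Mutual information of a joint pmf on a product of finite types. -/
def mutInfo {α β : Type} [Fintype α] [Fintype β] (p : α × β → ℝ) : ℝ :=
  ent (fun a => ∑ b, p (a, b)) + ent (fun b => ∑ a, p (a, b)) - ent p

/-- Conditional mutual information `I(X;Y|U)` of a joint pmf on `U × X × Y`,
via `I(X;Y|U) = H(U,X) + H(U,Y) − H(U,X,Y) − H(U)`. -/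
def condMutInfo {υ α β : Type} [Fintype υ] [Fintype α] [Fintype β]
    (p : υ × α × β → ℝ) : ℝ :=
  ent (fun ua : υ × α => ∑ b, p (ua.1, ua.2, b))
    + ent (fun ub : υ × β => ∑ a, p (ub.1, a, ub.2))
    - ent p
    - ent (fun u : υ => ∑ a, ∑ b, p (u, a, b))

section InfoQuantities

variable {𝒳 𝒮 𝒴 𝒴₁ : Type} [Fintype 𝒳] [Fintype 𝒮] [Fintype 𝒴] [Fintype 𝒴₁]

/-- `I_q(X;Y)` under input pmf `p(x)`, state pmf `q(s)` and channel `W`. -/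
def IqXY (W : 𝒳 → 𝒮 → 𝒴 × 𝒴₁ → ℝ) (p : 𝒳 → ℝ) (q : 𝒮 → ℝ) : ℝ :=
  mutInfo (fun xy : 𝒳 × 𝒴 => p xy.1 * ∑ s, q s * ∑ y1, W xy.1 s (xy.2, y1))

/-- `I_q(X;Y,Y₁)`. -/
def IqXYY1 (W : 𝒳 → 𝒮 → 𝒴 × 𝒴₁ → ℝ) (p : 𝒳 → ℝ) (q : 𝒮 → ℝ) : ℝ :=
  mutInfo (fun xz : 𝒳 × (𝒴 × 𝒴₁) => p xz.1 * ∑ s, q s * W xz.1 s xz.2)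

/-- `I_q(U;Y)` under input pmf `p(u,x)` (auxiliary alphabet `Fin k`). -/
def IqUY {k : ℕ} (W : 𝒳 → 𝒮 → 𝒴 × 𝒴₁ → ℝ) (p : Fin k × 𝒳 → ℝ) (q : 𝒮 → ℝ) : ℝ :=
  mutInfo (fun uy : Fin k × 𝒴 => ∑ x, ∑ s, ∑ y1, p (uy.1, x) * q s * W x s (uy.2, y1))

/-- `I_q(U;Y₁)` under input pmf `p(u,x)`. -/
def IqUY1 {k : ℕ} (W : 𝒳 → 𝒮 → 𝒴 × 𝒴₁ → ℝ) (p : Fin k × 𝒳 → ℝ) (q : 𝒮 → ℝ) : ℝ :=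
  mutInfo (fun uy : Fin k × 𝒴₁ => ∑ x, ∑ s, ∑ y, p (uy.1, x) * q s * W x s (y, uy.2))

/-- `I_q(X;Y|U)` under input pmf `p(u,x)`. -/
def IqXYgivenU {k : ℕ} (W : 𝒳 → 𝒮 → 𝒴 × 𝒴₁ → ℝ) (p : Fin k × 𝒳 → ℝ) (q : 𝒮 → ℝ) : ℝ :=
  condMutInfo (fun uxy : Fin k × 𝒳 × 𝒴 =>
    p (uxy.1, uxy.2.1) * ∑ s, q s * ∑ y1, W uxy.2.1 s (uxy.2.2, y1))

/-- The partial decode-forward lower bound `R_DF(Q)`: the supremum over all finite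
auxiliary alphabets (represented by `Fin k`) and input pmfs `p(u,x)` of
`min{ inf_q I_q(U;Y) + inf_q I_q(X;Y|U) + C₁, inf_q I_q(U;Y₁) + inf_q I_q(X;Y|U) }`. -/
def RDF (W : 𝒳 → 𝒮 → 𝒴 × 𝒴₁ → ℝ) (C1 : ℝ) (Q : Set (𝒮 → ℝ)) : ℝ :=
  sSup {r | ∃ (k : ℕ) (p : Fin k × 𝒳 → ℝ), IsPMF p ∧
    r = min
      (sInf {v | ∃ q ∈ Q, v = IqUY W p q} + sInf {v | ∃ q ∈ Q, v = IqXYgivenU W p q} + C1)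
      (sInf {v | ∃ q ∈ Q, v = IqUY1 W p q} + sInf {v | ∃ q ∈ Q, v = IqXYgivenU W p q})}

/-- The cutset upper bound
`R_CS(Q) = inf_{q∈Q} max_{p(x)} min{ I_q(X;Y) + C₁, I_q(X;Y,Y₁) }`. -/
def RCS (W : 𝒳 → 𝒮 → 𝒴 × 𝒴₁ → ℝ) (C1 : ℝ) (Q : Set (𝒮 → ℝ)) : ℝ :=
  sInf {r | ∃ q ∈ Q, r = sSup {v | ∃ p : 𝒳 → ℝ, IsPMF p ∧
    v = min (IqXY W p q + C1) (IqXYY1 W p q)}}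

end InfoQuantities

/-- A deterministic code for the primitive relay channel: a message encoder, a relay
function mapping the relay's received block to one of `L` indices sent over the
noiseless link, and a decoder using the channel output together with that index. -/
structure PCode (𝒳 𝒴 𝒴₁ : Type) (n M L : ℕ) where
  f : Fin M → Fin n → 𝒳
  f1 : (Fin n → 𝒴₁) → Fin L
  g : (Fin n → 𝒴) × Fin L → Fin M

/-- The noiseless link of rate `C₁` supports `L` indices when `L ≤ 2^{nC₁}`. -/
def LinkOK (n L : ℕ) (C1 : ℝ) : Prop := 1 ≤ L ∧ (L : ℝ) ≤ (2 : ℝ) ^ ((n : ℝ) * C1)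

section Codes

variable {𝒳 𝒮 𝒴 𝒴₁ : Type} [Fintype 𝒳] [Fintype 𝒮] [Fintype 𝒴] [Fintype 𝒴₁]
variable {n M L : ℕ}

/-- Conditional probability of error of the code given the state sequence `s`. -/
def PCode.errGiven (C : PCode 𝒳 𝒴 𝒴₁ n M L) (W : 𝒳 → 𝒮 → 𝒴 × 𝒴₁ → ℝ)
    (s : Fin n → 𝒮) : ℝ :=
  (M : ℝ)⁻¹ * ∑ m : Fin M, ∑ y : Fin n → 𝒴, ∑ y1 : Fin n → 𝒴₁,
    if C.g (y, C.f1 y1) = m then 0 else ∏ i, W (C.f m i) (s i) (y i, y1 i)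

/-- Average error probability under an i.i.d. state distribution `q`. -/
def PCode.errIID (C : PCode 𝒳 𝒴 𝒴₁ n M L) (W : 𝒳 → 𝒮 → 𝒴 × 𝒴₁ → ℝ)
    (q : 𝒮 → ℝ) : ℝ :=
  ∑ s : Fin n → 𝒮, (∏ i, q (s i)) * C.errGiven W s

/-- Average error probability under an arbitrary joint state distribution `qn`. -/
def PCode.errJoint (C : PCode 𝒳 𝒴 𝒴₁ n M L) (W : 𝒳 → 𝒮 → 𝒴 × 𝒴₁ → ℝ)
    (qn : (Fin n → 𝒮) → ℝ) : ℝ :=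
  ∑ s : Fin n → 𝒮, qn s * C.errGiven W s

end Codes

section Capacities

variable {𝒳 𝒮 𝒴 𝒴₁ : Type} [Fintype 𝒳] [Fintype 𝒮] [Fintype 𝒴] [Fintype 𝒴₁]

/-- `R` is achievable by deterministic codes over the compound primitive relay
channel with state set `Q`. -/
def CompAchievable (W : 𝒳 → 𝒮 → 𝒴 × 𝒴₁ → ℝ) (C1 : ℝ) (Q : Set (𝒮 → ℝ)) (R : ℝ) : Prop :=
  ∀ ε > (0 : ℝ), ∃ N : ℕ, ∀ n ≥ N, ∃ (M L : ℕ) (C : PCode 𝒳 𝒴 𝒴₁ n M L),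
    (2 : ℝ) ^ ((n : ℝ) * R) ≤ (M : ℝ) ∧ LinkOK n L C1 ∧
    ∀ q ∈ Q, C.errIID W q ≤ ε

/-- The deterministic code capacity of the compound primitive relay channel. -/
def CompCapacity (W : 𝒳 → 𝒮 → 𝒴 × 𝒴₁ → ℝ) (C1 : ℝ) (Q : Set (𝒮 → ℝ)) : ℝ :=
  sSup {R | CompAchievable W C1 Q R}

/-- `R` is achievable by random codes over the compound primitive relay channel. -/
def CompRandAchievable (W : 𝒳 → 𝒮 → 𝒴 × 𝒴₁ → ℝ) (C1 : ℝ) (Q : Set (𝒮 → ℝ)) (R : ℝ) :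
    Prop :=
  ∀ ε > (0 : ℝ), ∃ N : ℕ, ∀ n ≥ N, ∃ (M L : ℕ),
    (2 : ℝ) ^ ((n : ℝ) * R) ≤ (M : ℝ) ∧ LinkOK n L C1 ∧
    ∃ (J : Type) (π : PMF J) (Cs : J → PCode 𝒳 𝒴 𝒴₁ n M L),
      ∀ q ∈ Q, (∑' j, π j * ENNReal.ofReal ((Cs j).errIID W q)) ≤ ENNReal.ofReal ε

/-- The random code capacity of the compound primitive relay channel. -/
def CompRandCapacity (W : 𝒳 → 𝒮 → 𝒴 × 𝒴₁ → ℝ) (C1 : ℝ) (Q : Set (𝒮 → ℝ)) : ℝ :=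
  sSup {R | CompRandAchievable W C1 Q R}

/-- `R` is achievable by deterministic codes over the primitive AVRC: the average
error is small under every joint state distribution. -/
def AVRCAchievable (W : 𝒳 → 𝒮 → 𝒴 × 𝒴₁ → ℝ) (C1 R : ℝ) : Prop :=
  ∀ ε > (0 : ℝ), ∃ N : ℕ, ∀ n ≥ N, ∃ (M L : ℕ) (C : PCode 𝒳 𝒴 𝒴₁ n M L),
    (2 : ℝ) ^ ((n : ℝ) * R) ≤ (M : ℝ) ∧ LinkOK n L C1 ∧
    ∀ qn : (Fin n → 𝒮) → ℝ, IsPMF qn → C.errJoint W qn ≤ ε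

/-- The deterministic code capacity of the primitive AVRC. -/
def AVRCCapacity (W : 𝒳 → 𝒮 → 𝒴 × 𝒴₁ → ℝ) (C1 : ℝ) : ℝ :=
  sSup {R | AVRCAchievable W C1 R}

/-- `R` is achievable by random codes over the primitive AVRC. -/
def AVRCRandAchievable (W : 𝒳 → 𝒮 → 𝒴 × 𝒴₁ → ℝ) (C1 R : ℝ) : Prop :=
  ∀ ε > (0 : ℝ), ∃ N : ℕ, ∀ n ≥ N, ∃ (M L : ℕ),
    (2 : ℝ) ^ ((n : ℝ) * R) ≤ (M : ℝ) ∧ LinkOK n L C1 ∧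
    ∃ (J : Type) (π : PMF J) (Cs : J → PCode 𝒳 𝒴 𝒴₁ n M L),
      ∀ qn : (Fin n → 𝒮) → ℝ, IsPMF qn →
        (∑' j, π j * ENNReal.ofReal ((Cs j).errJoint W qn)) ≤ ENNReal.ofReal ε

/-- The random code capacity of the primitive AVRC. -/
def AVRCRandCapacity (W : 𝒳 → 𝒮 → 𝒴 × 𝒴₁ → ℝ) (C1 : ℝ) : ℝ :=
  sSup {R | AVRCRandAchievable W C1 R}

end Capacities

/-- The channel is reversely strongly degraded:
`W(y,y₁|x,s) = W_{Y|X,S}(y|x,s)·W_{Y₁|Y}(y₁|y)`. -/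
def RevStronglyDegraded {𝒳 𝒮 𝒴 𝒴₁ : Type} [Fintype 𝒴] [Fintype 𝒴₁]
    (W : 𝒳 → 𝒮 → 𝒴 × 𝒴₁ → ℝ) : Prop :=
  ∃ (WY : 𝒳 → 𝒮 → 𝒴 → ℝ) (V : 𝒴 → 𝒴₁ → ℝ),
    (∀ x s, IsPMF (WY x s)) ∧ (∀ y, IsPMF (V y)) ∧
    ∀ x s y y1, W x s (y, y1) = WY x s y * V y y1

/-- A state-dependent DMC `V(z|x,s)` is symmetrizable. -/
def Symmetrizable {𝒳 𝒮 𝒵 : Type} [Fintype 𝒮] (V : 𝒳 → 𝒮 → 𝒵 → ℝ) : Prop :=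
  ∃ J : 𝒳 → 𝒮 → ℝ, (∀ x, IsPMF (J x)) ∧
    ∀ x x' z, (∑ s, V x s z * J x' s) = ∑ s, V x' s z * J x s


section SingleLetter

variable {α β : Type} [Fintype α]

/-- Output distribution of the channel `w` under the input distribution `p`. -/
def outDist (p : α → ℝ) (w : α → β → ℝ) (y : β) : ℝ := ∑ x, p x * w x y

/-- The likelihood ratio of the channel to its output distribution. -/
def densityRatio (p : α → ℝ) (w : α → β → ℝ) (x : α) (y : β) : ℝ := w x y / outDist p w y

lemma outDist_nonneg {p : α → ℝ} {w : α → β → ℝ} (hp : ∀ x, 0 ≤ p x) (hw : ∀ x y, 0 ≤ w x y)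
    (y : β) : 0 ≤ outDist p w y :=
  Finset.sum_nonneg fun x _ => mul_nonneg (hp x) (hw x y)

lemma mul_le_outDist {p : α → ℝ} {w : α → β → ℝ} (hp : ∀ x, 0 ≤ p x) (hw : ∀ x y, 0 ≤ w x y)
    (x : α) (y : β) : p x * w x y ≤ outDist p w y :=
  Finset.single_le_sum (f := fun x => p x * w x y)
    (fun x _ => mul_nonneg (hp x) (hw x y)) (Finset.mem_univ x)

lemma densityRatio_nonneg {p : α → ℝ} {w : α → β → ℝ} (hp : ∀ x, 0 ≤ p x)
    (hw : ∀ x y, 0 ≤ w x y) (x : α) (y : β) : 0 ≤ densityRatio p w x y :=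
  div_nonneg (hw x y) (outDist_nonneg hp hw y)

lemma densityRatio_pos {p : α → ℝ} {w : α → β → ℝ} (hp : ∀ x, 0 ≤ p x)
    (hw : ∀ x y, 0 ≤ w x y) {x : α} {y : β} (h : 0 < p x * w x y) : 0 < densityRatio p w x y := by
  have hwp : 0 < w x y := (pos_iff_pos_of_mul_pos h).1 (lt_of_le_of_ne (hp x) (by
    rintro h0; simp [← h0] at h))
  exact div_pos hwp (h.trans_le (mul_le_outDist hp hw x y))

lemma sum_mul_densityRatio_le_one (p : α → ℝ) (w : α → β → ℝ) (y : β) :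
    ∑ x, p x * densityRatio p w x y ≤ 1 := by
  have : ∑ x, p x * densityRatio p w x y = outDist p w y / outDist p w y := by
    simp only [densityRatio, ← mul_div_assoc, ← Finset.sum_div]
    rfl
  rw [this]
  exact div_self_le_one _

variable [Fintype β]

/-- Mutual information in nats, in the form `H(Y) - H(Y|X)`. -/
def mutInfoNat (p : α → ℝ) (w : α → β → ℝ) : ℝ :=
  ∑ y, Real.negMulLog (outDist p w y) - ∑ x, p x * ∑ y, Real.negMulLog (w x y)

lemma mutInfo_eq_mutInfoNat_div {p : α → ℝ} {w : α → β → ℝ}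
    (hw : ∀ x, ∑ y, w x y = 1) :
    mutInfo (fun xy : α × β => p xy.1 * w xy.1 xy.2) = mutInfoNat p w / Real.log 2 := by
  have hent : ∀ {γ : Type} [Fintype γ] (f : γ → ℝ), ent f = (∑ a, Real.negMulLog (f a)) / Real.log 2 := by
    intro γ _ f
    simp only [ent, Real.negMulLog, Real.logb, Finset.sum_div, ← Finset.sum_neg_distrib]
    refine Finset.sum_congr rfl fun a _ => ?_
    ring
  simp only [mutInfo, hent, ← add_div, ← sub_div]
  congr 1
  simp only [← Finset.mul_sum, hw, mul_one, Fintype.sum_prod_type, Real.negMulLog_mul,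
    Finset.sum_add_distrib, ← Finset.sum_mul, one_mul, mutInfoNat, outDist]
  ring

lemma mutInfoNat_eq_sum {p : α → ℝ} {w : α → β → ℝ} (hp : ∀ x, 0 ≤ p x) (hw : ∀ x y, 0 ≤ w x y) :
    mutInfoNat p w = ∑ x, ∑ y, p x * w x y * Real.log (densityRatio p w x y) := by
  have h1 : ∑ y, Real.negMulLog (outDist p w y)
      = ∑ x, ∑ y, -(p x * w x y * Real.log (outDist p w y)) := by
    rw [Finset.sum_comm]
    refine Finset.sum_congr rfl fun y _ => ?_
    rw [Finset.sum_neg_distrib, ← Finset.sum_mul, Real.negMulLog, neg_mul]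
    rfl
  rw [mutInfoNat, h1, ← Finset.sum_sub_distrib]
  refine Finset.sum_congr rfl fun x _ => ?_
  rw [Finset.mul_sum, ← Finset.sum_sub_distrib]
  refine Finset.sum_congr rfl fun y _ => ?_
  rcases eq_or_ne (p x * w x y) 0 with h | h
  · have : p x * Real.negMulLog (w x y) = 0 := by
      rcases mul_eq_zero.1 h with h | h <;> simp [h]
    simp [h, this]
  · have hpos : 0 < p x * w x y := lt_of_le_of_ne (mul_nonneg (hp x) (hw x y)) h.symm
    rw [densityRatio, Real.log_div (right_ne_zero_of_mul h)
      (hpos.trans_le (mul_le_outDist hp hw x y)).ne', Real.negMulLog]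
    ring

/-- The likelihood ratio is the best test function for its own channel. -/
lemma sum_log_le_mutInfoNat {p : α → ℝ} {w r : α → β → ℝ} (hp : IsPMF p)
    (hw : ∀ x, IsPMF (w x)) (hr1 : ∀ y, ∑ x, p x * r x y ≤ 1) (hr0 : ∀ x y, 0 ≤ r x y)
    (hr : ∀ x y, 0 < p x * w x y → 0 < r x y) :
    ∑ x, ∑ y, p x * w x y * Real.log (r x y) ≤ mutInfoNat p w := by
  have hw0 : ∀ x y, 0 ≤ w x y := fun x => (hw x).1
  rw [mutInfoNat_eq_sum hp.1 hw0, ← sub_nonneg, ← Finset.sum_sub_distrib]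
  have hterm : ∀ x y, p x * w x y - p x * r x y * outDist p w y
      ≤ p x * w x y * Real.log (densityRatio p w x y) - p x * w x y * Real.log (r x y) := by
    intro x y
    rcases (mul_nonneg (hp.1 x) (hw0 x y)).eq_or_lt with h | h
    · rw [← h]
      have := mul_nonneg (mul_nonneg (hp.1 x) (hr0 x y)) (outDist_nonneg hp.1 hw0 y)
      simpa using this
    · have hd := densityRatio_pos hp.1 hw0 h
      have hr' := hr x y h
      have hP : 0 < outDist p w y := h.trans_le (mul_le_outDist hp.1 hw0 x y)
      have hwx : w x y ≠ 0 := right_ne_zero_of_mul h.ne'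
      rw [← mul_sub, ← Real.log_div hd.ne' hr'.ne']
      calc p x * w x y - p x * r x y * outDist p w y
          = p x * w x y * (1 - (densityRatio p w x y / r x y)⁻¹) := by
            rw [densityRatio]; field_simp
        _ ≤ _ := mul_le_mul_of_nonneg_left (Real.one_sub_inv_le_log_of_pos (div_pos hd hr')) h.le
  have hsum1 : ∑ x, ∑ y, p x * w x y = 1 := by
    simp only [← Finset.mul_sum, (hw _).2, mul_one, hp.2]
  have hsum2 : ∑ x, ∑ y, p x * r x y * outDist p w y ≤ 1 := by
    rw [Finset.sum_comm]
    calc ∑ y, ∑ x, p x * r x y * outDist p w y ≤ ∑ y, outDist p w y := by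
          refine Finset.sum_le_sum fun y _ => ?_
          rw [← Finset.sum_mul]
          exact mul_le_of_le_one_left (outDist_nonneg hp.1 hw0 y) (hr1 y)
      _ = 1 := by rw [← hsum1, Finset.sum_comm]; rfl
  calc (0 : ℝ) ≤ ∑ x, ∑ y, p x * w x y - ∑ x, ∑ y, p x * r x y * outDist p w y := by linarith
    _ ≤ _ := by
      rw [← Finset.sum_sub_distrib]
      refine Finset.sum_le_sum fun x _ => ?_
      rw [← Finset.sum_sub_distrib, ← Finset.sum_sub_distrib]
      exact Finset.sum_le_sum fun y _ => hterm x y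

lemma continuous_mutInfoNat :
    Continuous fun z : (α → ℝ) × (α → β → ℝ) => mutInfoNat z.1 z.2 := by
  unfold mutInfoNat outDist
  have := Real.continuous_negMulLog
  fun_prop

lemma concaveOn_mutInfoNat {w : α → β → ℝ} (hw : ∀ x y, 0 ≤ w x y) :
    ConcaveOn ℝ (stdSimplex ℝ α) fun p => mutInfoNat p w := by
  refine ⟨convex_stdSimplex ℝ α, fun p hp p' hp' a b ha hb hab => ?_⟩
  have hout : ∀ y, outDist (a • p + b • p') w y = a • outDist p w y + b • outDist p' w y := by
    intro y
    simp only [outDist, Pi.add_apply, Pi.smul_apply, smul_eq_mul, Finset.mul_sum,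
      ← Finset.sum_add_distrib]
    exact Finset.sum_congr rfl fun x _ => by ring
  have hH : ∑ y, (a * Real.negMulLog (outDist p w y) + b * Real.negMulLog (outDist p' w y))
      ≤ ∑ y, Real.negMulLog (outDist (a • p + b • p') w y) := by
    refine Finset.sum_le_sum fun y _ => ?_
    rw [hout]
    exact Real.concaveOn_negMulLog.2 (outDist_nonneg hp.1 hw y) (outDist_nonneg hp'.1 hw y)
      ha hb hab
  simp only [mutInfoNat, smul_eq_mul, Pi.add_apply, Pi.smul_apply, add_mul, mul_assoc,
    Finset.sum_add_distrib, ← Finset.mul_sum] at hH ⊢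
  linarith

lemma sum_combo_mul_log (p : α → ℝ) (w w₁ w₂ r : α → β → ℝ) (a b : ℝ)
    (hw : ∀ x y, w x y = a * w₁ x y + b * w₂ x y) :
    ∑ x, ∑ y, p x * w x y * Real.log (r x y)
      = a * (∑ x, ∑ y, p x * w₁ x y * Real.log (r x y))
        + b * ∑ x, ∑ y, p x * w₂ x y * Real.log (r x y) := by
  simp only [Finset.mul_sum, ← Finset.sum_add_distrib, hw]
  exact Finset.sum_congr rfl fun x _ => Finset.sum_congr rfl fun y _ => by ring

end SingleLetter

section Saddle

variable {α β σ : Type} [Fintype σ]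

/-- The channel `K` averaged over its state. -/
def avgChannel (K : α → σ → β → ℝ) (q : σ → ℝ) (x : α) (y : β) : ℝ := ∑ s, q s * K x s y

lemma avgChannel_combo (K : α → σ → β → ℝ) (q q' : σ → ℝ) (a b : ℝ) (x : α) (y : β) :
    avgChannel K (a • q + b • q') x y = a * avgChannel K q x y + b * avgChannel K q' x y := by
  simp only [avgChannel, Pi.add_apply, Pi.smul_apply, smul_eq_mul, Finset.mul_sum,
    ← Finset.sum_add_distrib]
  exact Finset.sum_congr rfl fun x _ => by ring

lemma continuous_avgChannel (K : α → σ → β → ℝ) : Continuous (avgChannel K) := by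
  unfold avgChannel
  fun_prop

variable [Fintype β]

lemma isPMF_avgChannel {K : α → σ → β → ℝ} {q : σ → ℝ} (hK : IsChannel K) (hq : IsPMF q) (x : α) :
    IsPMF (avgChannel K q x) := by
  refine ⟨fun y => Finset.sum_nonneg fun s _ => mul_nonneg (hq.1 s) ((hK x s).1 y), ?_⟩
  simp only [avgChannel]
  rw [Finset.sum_comm]
  simp only [← Finset.mul_sum, (hK x _).2, mul_one, hq.2]

lemma avgChannel_pos {K : α → σ → β → ℝ} {q : σ → ℝ} (hK : IsChannel K) (hq : IsPMF q)
    (hsupp : ∀ x s s' y, 0 < K x s y → 0 < K x s' y) {x : α} {s : σ} {y : β} (h : 0 < K x s y) :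
    0 < avgChannel K q x y := by
  obtain ⟨s', hs'⟩ : ∃ s', 0 < q s' := by
    by_contra! hcon
    have := hq.2
    rw [Finset.sum_eq_zero fun s _ => le_antisymm (hcon s) (hq.1 s)] at this
    exact zero_ne_one this
  exact Finset.sum_pos' (fun s _ => mul_nonneg (hq.1 s) ((hK x s).1 y))
    ⟨s', Finset.mem_univ _, mul_pos hs' (hsupp _ _ _ _ h)⟩

variable [Fintype α]

lemma convexOn_mutInfoNat_avgChannel {K : α → σ → β → ℝ} (hK : IsChannel K) {p : α → ℝ}
    (hp : IsPMF p) : ConvexOn ℝ (stdSimplex ℝ σ) fun q => mutInfoNat p (avgChannel K q) := by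
  refine convexOn_iff_forall_pos.2 ⟨convex_stdSimplex ℝ σ, fun q hq q' hq' a b ha hb hab => ?_⟩
  have hq'' : IsPMF (a • q + b • q') := convex_stdSimplex ℝ σ hq hq' ha.le hb.le hab
  have hw := isPMF_avgChannel hK hq''
  have h1 := isPMF_avgChannel hK hq
  have h2 := isPMF_avgChannel hK hq'
  have hc := avgChannel_combo K q q' a b
  have key : ∀ w : α → β → ℝ, (∀ x, IsPMF (w x)) → (∀ x y, 0 < w x y →
      0 < avgChannel K (a • q + b • q') x y) →
      ∑ x, ∑ y, p x * w x y * Real.log (densityRatio p (avgChannel K (a • q + b • q')) x y)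
        ≤ mutInfoNat p w := by
    intro w hw' hpos
    refine sum_log_le_mutInfoNat hp hw' (sum_mul_densityRatio_le_one _ _)
      (densityRatio_nonneg hp.1 fun x => (hw x).1) fun x y h => ?_
    refine densityRatio_pos hp.1 (fun x => (hw x).1) ?_
    have hpx : 0 < p x := lt_of_le_of_ne (hp.1 x) (by rintro h0; simp [← h0] at h)
    exact mul_pos hpx (hpos x y ((pos_iff_pos_of_mul_pos h).1 hpx))
  simp only [smul_eq_mul]
  rw [mutInfoNat_eq_sum hp.1 fun x => (hw x).1, sum_combo_mul_log p _ _ _ _ a b hc]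
  refine add_le_add (mul_le_mul_of_nonneg_left (key _ h1 fun x y h => ?_) ha.le)
    (mul_le_mul_of_nonneg_left (key _ h2 fun x y h => ?_) hb.le)
  · rw [hc]
    exact add_pos_of_pos_of_nonneg (mul_pos ha h) (mul_nonneg hb.le ((h2 x).1 y))
  · rw [hc]
    exact add_pos_of_nonneg_of_pos (mul_nonneg ha.le ((h1 x).1 y)) (mul_pos hb h)

/-- First-order optimality of a least favourable state distribution. -/
lemma mutInfoNat_le_sum_log_of_isMinOn {K : α → σ → β → ℝ} (hK : IsChannel K)
    (hsupp : ∀ x s s' y, 0 < K x s y → 0 < K x s' y) {p : α → ℝ} (hp : IsPMF p) {q : σ → ℝ}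
    (hq : IsPMF q) (hmin : IsMinOn (fun q => mutInfoNat p (avgChannel K q)) (stdSimplex ℝ σ) q)
    (s : σ) :
    mutInfoNat p (avgChannel K q)
      ≤ ∑ x, ∑ y, p x * K x s y * Real.log (densityRatio p (avgChannel K q) x y) := by
  classical
  set e : σ → ℝ := Pi.single s 1
  have he : IsPMF e := single_mem_stdSimplex ℝ s
  have hes : ∀ x y, avgChannel K e x y = K x s y := fun x y => by
    simp [avgChannel, e, Pi.single_apply]
  set qt : ℝ → σ → ℝ := fun t => (1 - t) • q + t • e
  have hqt : ∀ t ∈ Set.Ioo (0 : ℝ) 1, IsPMF (qt t) := fun t ht =>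
    convex_stdSimplex ℝ σ hq he (by linarith [ht.2]) ht.1.le (by ring)
  have hqt0 : qt 0 = q := by simp [qt]
  have hcont : ContinuousAt (fun t => ∑ x, ∑ y, p x * K x s y *
      Real.log (densityRatio p (avgChannel K (qt t)) x y)) 0 := by
    refine tendsto_finsetSum _ fun x _ => tendsto_finsetSum _ fun y _ => ?_
    rcases (mul_nonneg (hp.1 x) ((hK x s).1 y)).eq_or_lt with h | h
    · simp [← h]
    · have hpx : 0 < p x := lt_of_le_of_ne (hp.1 x) (by rintro h0; simp [← h0] at h)
      have hKx := (pos_iff_pos_of_mul_pos h).1 hpx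
      have hw0 : ∀ x y, 0 ≤ avgChannel K q x y := fun x => (isPMF_avgChannel hK hq x).1
      have hpos : 0 < p x * avgChannel K q x y := mul_pos hpx (avgChannel_pos hK hq hsupp hKx)
      have hc : Continuous fun t => avgChannel K (qt t) := by
        refine (continuous_avgChannel K).comp ?_
        fun_prop
      have hc' : ∀ x y, Continuous fun t => avgChannel K (qt t) x y := fun x y =>
        (continuous_apply y).comp ((continuous_apply x).comp hc)
      refine Filter.Tendsto.const_mul _ (Filter.Tendsto.log ?_ ?_)
      · refine ContinuousAt.div (hc' x y).continuousAt
          (continuous_finsetSum _ fun x _ => (hc' x y).const_mul (p x)).continuousAt ?_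
        · rw [hqt0]
          exact (hpos.trans_le (mul_le_outDist hp.1 hw0 x y)).ne'
      · rw [hqt0]
        exact (densityRatio_pos hp.1 hw0 hpos).ne'
  have hlim := hcont.tendsto.mono_left (nhdsWithin_le_nhds (s := Set.Ioi (0 : ℝ)))
  simp only [hqt0] at hlim
  refine ge_of_tendsto hlim ?_
  filter_upwards [Ioo_mem_nhdsGT (zero_lt_one' ℝ)] with t ht
  have hpmf := hqt t ht
  have hw := isPMF_avgChannel hK hpmf
  have h1 : mutInfoNat p (avgChannel K q) ≤ mutInfoNat p (avgChannel K (qt t)) := hmin hpmf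
  have h2 : ∑ x, ∑ y, p x * avgChannel K q x y *
      Real.log (densityRatio p (avgChannel K (qt t)) x y) ≤ mutInfoNat p (avgChannel K q) := by
    refine sum_log_le_mutInfoNat hp (isPMF_avgChannel hK hq) (sum_mul_densityRatio_le_one _ _)
      (densityRatio_nonneg hp.1 fun x => (hw x).1) fun x y h => ?_
    refine densityRatio_pos hp.1 (fun x => (hw x).1) (lt_of_lt_of_le (mul_pos
      (by linarith [ht.2] : 0 < 1 - t) h) ?_)
    have := mul_nonneg (hp.1 x) (mul_nonneg ht.1.le ((hK x s).1 y))
    rw [avgChannel_combo, hes]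
    linarith
  rw [mutInfoNat_eq_sum hp.1 fun x => (hw x).1, sum_combo_mul_log p _ _ _ _ (1 - t) t
    (avgChannel_combo K q e (1 - t) t)] at h1
  simp only [hes] at h1
  have h3 := mul_le_mul_of_nonneg_left h2 (by linarith [ht.2] : 0 ≤ 1 - t)
  refine le_of_mul_le_mul_left ?_ ht.1
  linarith

lemma exists_saddle [Nonempty α] [Nonempty σ] {K : α → σ → β → ℝ} (hK : IsChannel K) :
    ∃ (p : α → ℝ) (q : σ → ℝ), IsPMF p ∧ IsPMF q ∧
      (∀ p', IsPMF p' → mutInfoNat p' (avgChannel K q) ≤ mutInfoNat p (avgChannel K q)) ∧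
      IsMinOn (fun q => mutInfoNat p (avgChannel K q)) (stdSimplex ℝ σ) q := by
  classical
  have hne : ∀ (γ : Type) [Fintype γ] [Nonempty γ], (stdSimplex ℝ γ).Nonempty := fun γ _ _ =>
    ⟨_, single_mem_stdSimplex ℝ (Classical.arbitrary γ)⟩
  have hK' := continuous_avgChannel K
  obtain ⟨q, hq, p, hp, h⟩ := Sion.exists_isSaddlePointOn (hne σ) (convex_stdSimplex ℝ σ)
    (isCompact_stdSimplex ℝ σ) (f := fun q p => mutInfoNat p (avgChannel K q))
    (fun p _ => (Continuous.lowerSemicontinuous (continuous_mutInfoNat.comp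
      (continuous_const.prodMk hK'))).lowerSemicontinuousOn _)
    (fun p hp => (convexOn_mutInfoNat_avgChannel hK hp).quasiconvexOn)
    (convex_stdSimplex ℝ α) (hne α) (isCompact_stdSimplex ℝ α)
    (fun q _ => (Continuous.upperSemicontinuous (continuous_mutInfoNat.comp
      (continuous_id.prodMk continuous_const))).upperSemicontinuousOn _)
    (fun q hq => (concaveOn_mutInfoNat fun x => (isPMF_avgChannel hK hq x).1).quasiconcaveOn)
  exact ⟨p, q, hp, hq, fun p' hp' => h q hq p' hp', fun q' hq' => h q' hq' p hp⟩

end Saddle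

section ProductSums

variable {ι A : Type} [Fintype ι] [DecidableEq ι] [Fintype A]

lemma sum_pi_prod (f : ι → A → ℝ) : ∑ c : ι → A, ∏ i, f i (c i) = ∏ i, ∑ a, f i a := by
  rw [Finset.prod_univ_sum, Fintype.piFinset_univ]

lemma sum_pi_prod_eq_one {P : ι → A → ℝ} (hP : ∀ i, ∑ a, P i a = 1) :
    ∑ c : ι → A, ∏ i, P i (c i) = 1 := by
  rw [sum_pi_prod, Finset.prod_congr rfl fun i _ => hP i, Finset.prod_const_one]

lemma isPMF_pi {P : ι → A → ℝ} (hP : ∀ i, IsPMF (P i)) : IsPMF fun c : ι → A => ∏ i, P i (c i) :=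
  ⟨fun c => Finset.prod_nonneg fun i _ => (hP i).1 (c i), sum_pi_prod_eq_one fun i => (hP i).2⟩

lemma sum_pi_prod_mul {P : ι → A → ℝ} (hP : ∀ i, ∑ a, P i a = 1) (i : ι) (F : A → ℝ) :
    ∑ c : ι → A, (∏ k, P k (c k)) * F (c i) = ∑ a, P i a * F a := by
  have h : ∀ c : ι → A, (∏ k, P k (c k)) * F (c i)
      = ∏ k, (P k (c k) * if k = i then F (c k) else 1) := by
    intro c
    rw [Finset.prod_mul_distrib, Finset.prod_ite_eq' Finset.univ i, if_pos (Finset.mem_univ i)]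
  simp only [h]
  rw [sum_pi_prod (fun k a => P k a * if k = i then F a else 1), Finset.prod_eq_single i]
  · simp
  · intro k _ hk
    simp [hk, hP]
  · simp

lemma sum_pi_prod_mul_mul {P : ι → A → ℝ} (hP : ∀ i, ∑ a, P i a = 1) {i j : ι} (hij : i ≠ j)
    (F G : A → ℝ) :
    ∑ c : ι → A, (∏ k, P k (c k)) * (F (c i) * G (c j))
      = (∑ a, P i a * F a) * ∑ a, P j a * G a := by
  have h : ∀ c : ι → A, (∏ k, P k (c k)) * (F (c i) * G (c j))
      = ∏ k, (P k (c k) * ((if k = i then F (c k) else 1) * if k = j then G (c k) else 1)) := by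
    intro c
    rw [Finset.prod_mul_distrib, Finset.prod_mul_distrib, Finset.prod_ite_eq' Finset.univ i,
      if_pos (Finset.mem_univ i), Finset.prod_ite_eq' Finset.univ j, if_pos (Finset.mem_univ j)]
  simp only [h]
  rw [sum_pi_prod (fun k a => P k a * ((if k = i then F a else 1) * if k = j then G a else 1)),
    Finset.prod_eq_mul i j hij]
  · simp [hij, hij.symm]
  · intro k _ hk
    simp [hk.1, hk.2, hP]
  · simp
  · simp

end ProductSums

section RandomCoding

variable {α β σ : Type}

open Classical in
/-- The decoder choosing some message whose codeword has likelihood ratio at least `T`. -/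
def thresholdDecoder {M n : ℕ} (r : α → β → ℝ) (T : ℝ) (m₀ : Fin M) (c : Fin M → Fin n → α)
    (y : Fin n → β) : Fin M :=
  if h : ∃ m, T ≤ ∏ i, r (c m i) (y i) then h.choose else m₀

lemma thresholdDecoder_ne {M n : ℕ} {r : α → β → ℝ} {T : ℝ} {m₀ m : Fin M}
    {c : Fin M → Fin n → α} {y : Fin n → β} (h : thresholdDecoder r T m₀ c y ≠ m) :
    ∏ i, r (c m i) (y i) < T ∨ ∃ m' ≠ m, T ≤ ∏ i, r (c m' i) (y i) := by
  by_contra! hcon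
  have hex : ∃ m, T ≤ ∏ i, r (c m i) (y i) := ⟨m, hcon.1⟩
  rw [thresholdDecoder, dif_pos hex] at h
  exact (hcon.2 _ h).not_ge hex.choose_spec

variable [Fintype α] [Fintype β]

lemma exists_chernoff_bound {p : α → ℝ} {K : α → σ → β → ℝ} (hp : IsPMF p) (hK : IsChannel K)
    (L : α → β → ℝ) {γ v : ℝ} (hγ : γ < v)
    (hv : ∀ s, v ≤ ∑ x, ∑ y, p x * K x s y * L x y) :
    ∃ l ρ : ℝ, 0 < l ∧ 0 ≤ ρ ∧ ρ < 1 ∧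
      ∀ s, ∑ x, ∑ y, p x * K x s y * Real.exp (l * (γ - L x y)) ≤ ρ := by
  obtain ⟨B₀, hB₀⟩ : ∃ B₀ : ℝ, ∀ z : α × β, |γ - L z.1 z.2| ≤ B₀ := by
    obtain ⟨B₀, h⟩ := (Set.finite_range fun z : α × β => |γ - L z.1 z.2|).bddAbove
    exact ⟨B₀, fun z => h ⟨z, rfl⟩⟩
  set δ := v - γ with hδ
  have hδ0 : 0 < δ := sub_pos.2 hγ
  set B := max B₀ (max 1 δ) with hBdef
  have hB1 : 1 ≤ B := (le_max_left _ _).trans (le_max_right _ _)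
  have hBδ : δ ≤ B := (le_max_right _ _).trans (le_max_right _ _)
  have hB0 : 0 < B := by linarith
  have hB : ∀ x y, |γ - L x y| ≤ B := fun x y => (hB₀ (x, y)).trans (le_max_left _ _)
  set l := δ / (2 * B ^ 2) with hl
  have hl0 : 0 < l := by positivity
  have hlB : l * B ≤ 1 := by
    rw [hl, div_mul_eq_mul_div, div_le_one (by positivity)]
    nlinarith
  have hlB2 : l * B ^ 2 = δ / 2 := by rw [hl]; field_simp
  have hlδ : l * δ ≤ 1 := (mul_le_mul_of_nonneg_left hBδ hl0.le).trans hlB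
  refine ⟨l, 1 - l * δ / 2, hl0, by linarith, by nlinarith, fun s => ?_⟩
  have hexp : ∀ x y, Real.exp (l * (γ - L x y)) ≤ 1 + l * (γ - L x y) + l * δ / 2 := by
    intro x y
    have habs : |l * (γ - L x y)| ≤ l * B := by
      rw [abs_mul, abs_of_pos hl0]
      exact mul_le_mul_of_nonneg_left (hB x y) hl0.le
    have h1 := (abs_le.1 (Real.abs_exp_sub_one_sub_id_le (habs.trans hlB))).2
    have h2 : (l * (γ - L x y)) ^ 2 ≤ (l * B) ^ 2 := sq_le_sq' (abs_le.1 habs).1 (abs_le.1 habs).2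
    have h3 : (l * B) ^ 2 = l * δ / 2 := by
      rw [mul_pow, sq l, mul_assoc, hlB2]; ring
    linarith
  have hsum1 : ∑ x, ∑ y, p x * K x s y = 1 := by
    simp only [← Finset.mul_sum, (hK _ _).2, mul_one, hp.2]
  calc ∑ x, ∑ y, p x * K x s y * Real.exp (l * (γ - L x y))
      ≤ ∑ x, ∑ y, p x * K x s y * (1 + l * (γ - L x y) + l * δ / 2) :=
        Finset.sum_le_sum fun x _ => Finset.sum_le_sum fun y _ =>
          mul_le_mul_of_nonneg_left (hexp x y) (mul_nonneg (hp.1 x) ((hK x s).1 y))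
    _ = (1 + l * γ + l * δ / 2) * (∑ x, ∑ y, p x * K x s y)
          - l * ∑ x, ∑ y, p x * K x s y * L x y := by
        simp only [Finset.mul_sum, ← Finset.sum_sub_distrib]
        exact Finset.sum_congr rfl fun x _ => Finset.sum_congr rfl fun y _ => by ring
    _ ≤ 1 - l * δ / 2 := by
        rw [hsum1]
        nlinarith [hv s]

lemma sum_randomCodebook_error_le {p : α → ℝ} {K : α → σ → β → ℝ} {r : α → β → ℝ}
    (hp : IsPMF p) (hK : IsChannel K) (hr0 : ∀ x y, 0 ≤ r x y)
    (hr1 : ∀ y, ∑ x, p x * r x y ≤ 1) (hr : ∀ x s y, 0 < p x * K x s y → 0 < r x y)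
    {l γ ρ : ℝ} (hl : 0 < l)
    (hρ : ∀ s, ∑ x, ∑ y, p x * K x s y * Real.exp (l * (γ - Real.log (r x y))) ≤ ρ)
    {M n : ℕ} (m₀ m : Fin M) (s : Fin n → σ) :
    ∑ c : Fin M → Fin n → α, (∏ k, ∏ i, p (c k i)) * ∑ y : Fin n → β,
      (if thresholdDecoder r (Real.exp (n * γ)) m₀ c y = m then 0
        else ∏ i, K (c m i) (s i) (y i))
      ≤ ρ ^ n + M * Real.exp (-(n * γ)) := by
  classical
  set T := Real.exp (n * γ) with hT
  have hT0 : 0 < T := Real.exp_pos _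
  set P : (Fin n → α) → ℝ := fun x => ∏ i, p (x i) with hPdef
  have hP : IsPMF P := isPMF_pi (P := fun _ => p) fun _ => hp
  set w : (Fin n → α) → (Fin n → β) → ℝ := fun x y => ∏ i, K (x i) (s i) (y i) with hwdef
  have hw0 : ∀ x y, 0 ≤ w x y := fun x y => Finset.prod_nonneg fun i _ => (hK _ _).1 _
  have hw1 : ∀ x, ∑ y, w x y = 1 := fun x => sum_pi_prod_eq_one fun i => (hK _ _).2
  set a : (Fin n → α) → (Fin n → β) → ℝ := fun x y => ∏ i, r (x i) (y i) with hadef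
  have ha0 : ∀ x y, 0 ≤ a x y := fun x y => Finset.prod_nonneg fun i _ => hr0 _ _
  have ha1 : ∀ y, ∑ x, P x * a x y ≤ 1 := by
    intro y
    simp only [hPdef, hadef, ← Finset.prod_mul_distrib]
    rw [sum_pi_prod fun i x => p x * r x (y i)]
    exact Finset.prod_le_one
      (fun i _ => Finset.sum_nonneg fun x _ => mul_nonneg (hp.1 x) (hr0 _ _)) fun i _ => hr1 _
  set t : (Fin n → α) → (Fin n → β) → ℝ :=
    fun x y => ∏ i, Real.exp (l * (γ - Real.log (r (x i) (y i)))) with htdef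
  have ht0 : ∀ x y, 0 ≤ t x y := fun x y => Finset.prod_nonneg fun i _ => (Real.exp_pos _).le
  have hmiss : ∀ x y, 0 < P x * w x y → a x y < T → 1 ≤ t x y := by
    intro x y hpos hlt
    have hri : ∀ i, 0 < r (x i) (y i) := by
      intro i
      refine hr _ (s i) _ ?_
      rw [hPdef, hwdef, ← Finset.prod_mul_distrib] at hpos
      refine lt_of_le_of_ne (mul_nonneg (hp.1 _) ((hK _ _).1 _)) fun h0 => ?_
      exact hpos.ne' (Finset.prod_eq_zero (Finset.mem_univ i) h0.symm)
    have hlog : Real.log (a x y) = ∑ i, Real.log (r (x i) (y i)) :=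
      Real.log_prod fun i _ => (hri i).ne'
    have hlt' : Real.log (a x y) < n * γ :=
      (Real.log_lt_iff_lt_exp (Finset.prod_pos fun i _ => hri i)).2 hlt
    simp only [htdef]
    rw [← Real.exp_sum, ← Finset.mul_sum, Finset.sum_sub_distrib, ← hlog]
    refine Real.one_le_exp (mul_nonneg hl.le ?_)
    simpa using hlt'.le
  have hpoint : ∀ (c : Fin M → Fin n → α) (y : Fin n → β),
      (∏ k, P (c k)) * (if thresholdDecoder r T m₀ c y = m then 0 else w (c m) y)
        ≤ (∏ k, P (c k)) * (w (c m) y * t (c m) y)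
          + ∑ m' ∈ Finset.univ.erase m, (∏ k, P (c k)) * (w (c m) y * (a (c m') y / T)) := by
    intro c y
    have hPc : 0 ≤ ∏ k, P (c k) := Finset.prod_nonneg fun k _ => hP.1 _
    have hn2 : ∀ m', 0 ≤ (∏ k, P (c k)) * (w (c m) y * (a (c m') y / T)) := fun m' =>
      mul_nonneg hPc (mul_nonneg (hw0 _ _) (div_nonneg (ha0 _ _) hT0.le))
    have hn1 : 0 ≤ (∏ k, P (c k)) * (w (c m) y * t (c m) y) :=
      mul_nonneg hPc (mul_nonneg (hw0 _ _) (ht0 _ _))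
    split_ifs with hdec
    · rw [mul_zero]
      exact add_nonneg hn1 (Finset.sum_nonneg fun m' _ => hn2 m')
    · rcases thresholdDecoder_ne hdec with h | ⟨m', hm', h⟩
      · refine le_add_of_le_of_nonneg ?_ (Finset.sum_nonneg fun m' _ => hn2 m')
        rcases (mul_nonneg hPc (hw0 (c m) y)).eq_or_lt with h0 | h0
        · rw [← h0]
          exact hn1
        · have hPm : 0 < P (c m) * w (c m) y := by
            refine mul_pos (lt_of_le_of_ne (hP.1 _) fun hz => ?_)
              (lt_of_le_of_ne (hw0 _ _) fun hz => ?_)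
            · rw [Finset.prod_eq_zero (Finset.mem_univ m) hz.symm, zero_mul] at h0
              exact lt_irrefl _ h0
            · rw [← hz, mul_zero] at h0
              exact lt_irrefl _ h0
          exact mul_le_mul_of_nonneg_left
            (le_mul_of_one_le_right (hw0 _ _) (hmiss _ _ hPm h)) hPc
      · refine le_add_of_nonneg_of_le hn1 (le_trans ?_ (Finset.single_le_sum
          (f := fun m' => (∏ k, P (c k)) * (w (c m) y * (a (c m') y / T)))
          (fun m' _ => hn2 m') (Finset.mem_erase.2 ⟨hm', Finset.mem_univ m'⟩)))
        exact mul_le_mul_of_nonneg_left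
          (le_mul_of_one_le_right (hw0 _ _) ((one_le_div hT0).2 h)) hPc
  have hfirst : ∑ c : Fin M → Fin n → α, ∑ y, (∏ k, P (c k)) * (w (c m) y * t (c m) y)
      ≤ ρ ^ n := by
    simp only [← Finset.mul_sum]
    rw [sum_pi_prod_mul (P := fun _ => P) (fun _ => hP.2) m fun x => ∑ y, w x y * t x y]
    have : ∑ x, P x * ∑ y, w x y * t x y
        = ∏ i, ∑ x, ∑ y, p x * K x (s i) y * Real.exp (l * (γ - Real.log (r x y))) := by
      rw [← sum_pi_prod fun i x => ∑ y, p x * K x (s i) y * Real.exp (l * (γ - Real.log (r x y)))]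
      refine Finset.sum_congr rfl fun x _ => ?_
      rw [← sum_pi_prod fun i y => p (x i) * K (x i) (s i) y *
        Real.exp (l * (γ - Real.log (r (x i) y))), Finset.mul_sum]
      refine Finset.sum_congr rfl fun y _ => ?_
      simp only [hPdef, hwdef, htdef, Finset.prod_mul_distrib]
      ring
    rw [this]
    calc _ ≤ ∏ _i : Fin n, ρ := Finset.prod_le_prod (fun i _ => Finset.sum_nonneg fun x _ =>
            Finset.sum_nonneg fun y _ => mul_nonneg (mul_nonneg (hp.1 x) ((hK _ _).1 _))
              (Real.exp_pos _).le) fun i _ => hρ (s i)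
      _ = ρ ^ n := by simp
  have hsecond : ∀ m' ∈ Finset.univ.erase m, ∑ c : Fin M → Fin n → α, ∑ y,
      (∏ k, P (c k)) * (w (c m) y * (a (c m') y / T)) ≤ Real.exp (-(n * γ)) := by
    intro m' hm'
    rw [Finset.sum_comm]
    have hy : ∀ y, ∑ c : Fin M → Fin n → α, (∏ k, P (c k)) * (w (c m) y * (a (c m') y / T))
        ≤ (∑ x, P x * w x y) * T⁻¹ := by
      intro y
      rw [sum_pi_prod_mul_mul (P := fun _ => P) (fun _ => hP.2) (Finset.mem_erase.1 hm').1.symm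
        (fun x => w x y) fun x => a x y / T]
      refine mul_le_mul_of_nonneg_left ?_
        (Finset.sum_nonneg fun x _ => mul_nonneg (hP.1 x) (hw0 x y))
      simp only [div_eq_mul_inv, ← mul_assoc, ← Finset.sum_mul]
      exact mul_le_of_le_one_left (inv_nonneg.2 hT0.le) (ha1 y)
    refine (Finset.sum_le_sum fun y _ => hy y).trans_eq ?_
    rw [← Finset.sum_mul, Finset.sum_comm]
    simp only [← Finset.mul_sum, hw1, mul_one, hP.2, one_mul, hT, Real.exp_neg]
  calc _ = ∑ c : Fin M → Fin n → α, ∑ y, (∏ k, P (c k)) *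
        (if thresholdDecoder r T m₀ c y = m then 0 else w (c m) y) := by
        simp only [Finset.mul_sum, hPdef, hwdef]
    _ ≤ ∑ c : Fin M → Fin n → α, ∑ y, ((∏ k, P (c k)) * (w (c m) y * t (c m) y)
          + ∑ m' ∈ Finset.univ.erase m, (∏ k, P (c k)) * (w (c m) y * (a (c m') y / T))) :=
        Finset.sum_le_sum fun c _ => Finset.sum_le_sum fun y _ => hpoint c y
    _ = (∑ c : Fin M → Fin n → α, ∑ y, (∏ k, P (c k)) * (w (c m) y * t (c m) y))
          + ∑ m' ∈ Finset.univ.erase m, ∑ c : Fin M → Fin n → α, ∑ y,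
            (∏ k, P (c k)) * (w (c m) y * (a (c m') y / T)) := by
        simp only [Finset.sum_add_distrib]
        congr 1
        exact (Finset.sum_congr rfl fun c _ => Finset.sum_comm).trans Finset.sum_comm
    _ ≤ ρ ^ n + ∑ _m' ∈ Finset.univ.erase m, Real.exp (-(n * γ)) :=
        add_le_add hfirst (Finset.sum_le_sum hsecond)
    _ ≤ ρ ^ n + M * Real.exp (-(n * γ)) := by
        rw [Finset.sum_const, nsmul_eq_mul]
        gcongr
        simp

end RandomCoding

section Converse

variable {α β : Type} [Fintype α] [Fintype β]

lemma mutInfoNat_comp_le {γ : Type} [Fintype γ] {u : γ → ℝ} (hu : IsPMF u) (f : γ → α)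
    {w : α → β → ℝ} {C : ℝ} (hC : ∀ p, IsPMF p → mutInfoNat p w ≤ C) :
    mutInfoNat u (fun m => w (f m)) ≤ C := by
  classical
  set p : α → ℝ := fun x => ∑ m, if f m = x then u m else 0 with hpdef
  have hpush : ∀ F : α → ℝ, ∑ x, p x * F x = ∑ m, u m * F (f m) := by
    intro F
    simp only [hpdef, Finset.sum_mul, ite_mul, zero_mul]
    rw [Finset.sum_comm]
    simp
  have hp : IsPMF p := by
    refine ⟨fun x => Finset.sum_nonneg fun m _ => ?_, ?_⟩
    · split_ifs
      exacts [hu.1 m, le_rfl]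
    · simpa [hu.2] using hpush fun _ => 1
  have h : mutInfoNat u (fun m => w (f m)) = mutInfoNat p w := by
    simp only [mutInfoNat, outDist, hpush]
  exact h ▸ hC p hp

/-- The success probability of a block code with a randomized decoder `φ` is limited by the
single-letter mutual information of the channel. -/
lemma success_mul_log_le {w : α → β → ℝ} (hw : ∀ x, IsPMF (w x)) {C : ℝ}
    (hC : ∀ p, IsPMF p → mutInfoNat p w ≤ C) {M n : ℕ} (hM : 1 ≤ M) (f : Fin M → Fin n → α)
    {φ : (Fin n → β) → Fin M → ℝ} (hφ0 : ∀ y m, 0 ≤ φ y m) (hφ1 : ∀ y, ∑ m, φ y m ≤ 1) :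
    ((M : ℝ)⁻¹ * ∑ m, ∑ y : Fin n → β, (∏ i, w (f m i) (y i)) * φ y m) * Real.log M
      ≤ Real.log 2 + n * C := by
  have hM1 : (1 : ℝ) ≤ M := by exact_mod_cast hM
  have hM0 : (0 : ℝ) < M := by linarith
  set u : Fin M → ℝ := fun _ => (M : ℝ)⁻¹ with hu_def
  have hu : IsPMF u := ⟨fun _ => (inv_pos.2 hM0).le, by simp [u, hM0.ne']⟩
  set wi : Fin n → Fin M → β → ℝ := fun i m => w (f m i) with hwi
  have hwi0 : ∀ i m b, 0 ≤ wi i m b := fun i m => (hw _).1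
  set wn : Fin M → (Fin n → β) → ℝ := fun m y => ∏ i, wi i m (y i) with hwn
  have hwn0 : ∀ m y, 0 ≤ wn m y := fun m y => Finset.prod_nonneg fun i _ => hwi0 i m _
  have hwn1 : ∀ m, ∑ y, wn m y = 1 := fun m => sum_pi_prod_eq_one fun i => (hw _).2
  set Q : (Fin n → β) → ℝ := fun y => ∏ i, outDist u (wi i) (y i) with hQ
  have hQ0 : ∀ y, 0 ≤ Q y := fun y =>
    Finset.prod_nonneg fun i _ => outDist_nonneg hu.1 (hwi0 i) _
  have hQ1 : ∑ y, Q y = 1 := by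
    refine sum_pi_prod_eq_one fun i => ?_
    simp only [outDist]
    rw [Finset.sum_comm]
    simp only [← Finset.mul_sum, hwi, (hw _).2, mul_one, hu.2]
  set D : Fin M → (Fin n → β) → ℝ :=
    fun m y => ∑ i, Real.log (densityRatio u (wi i) m (y i)) with hD
  have hterm : ∀ m y, u m * wn m y - u m * (Q y * (M : ℝ) ^ φ y m / 2)
      ≤ u m * wn m y * D m y - u m * (wn m y * φ y m) * Real.log M
        + u m * wn m y * Real.log 2 := by
    intro m y
    have hum : 0 < u m := inv_pos.2 hM0
    have hpow : 0 < (M : ℝ) ^ φ y m := Real.rpow_pos_of_pos hM0 _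
    rcases (hwn0 m y).eq_or_lt with h | h
    · rw [← h]
      have : 0 ≤ u m * (Q y * (M : ℝ) ^ φ y m / 2) := by have := hQ0 y; positivity
      simpa using this
    · have hwpos : ∀ i, 0 < wi i m (y i) := fun i => lt_of_le_of_ne (hwi0 i m _) fun h0 =>
        h.ne' (Finset.prod_eq_zero (Finset.mem_univ i) h0.symm)
      have hout : ∀ i, 0 < outDist u (wi i) (y i) := fun i =>
        (mul_pos hum (hwpos i)).trans_le (mul_le_outDist hu.1 (hwi0 i) m _)
      have hQpos : 0 < Q y := Finset.prod_pos fun i _ => hout i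
      have hDlog : D m y = Real.log (wn m y / Q y) := by
        simp only [hD, hwn, hQ, densityRatio]
        rw [← Finset.prod_div_distrib, Real.log_prod fun i _ => (div_pos (hwpos i) (hout i)).ne']
      have hlog : Real.log (wn m y / (Q y * (M : ℝ) ^ φ y m / 2))
          = D m y - φ y m * Real.log M + Real.log 2 := by
        rw [hDlog, Real.log_div h.ne' (by positivity), Real.log_div (by positivity) two_ne_zero,
          Real.log_mul hQpos.ne' hpow.ne', Real.log_rpow hM0, Real.log_div h.ne' hQpos.ne']
        ring
      have hone := Real.one_sub_inv_le_log_of_pos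
        (div_pos h (by positivity : 0 < Q y * (M : ℝ) ^ φ y m / 2))
      rw [hlog] at hone
      have h2 := mul_le_mul_of_nonneg_left hone (mul_pos hum h).le
      have h3 : u m * wn m y * (1 - (wn m y / (Q y * (M : ℝ) ^ φ y m / 2))⁻¹)
          = u m * wn m y - u m * (Q y * (M : ℝ) ^ φ y m / 2) := by
        rw [inv_div]
        field_simp
      rw [h3] at h2
      linarith
  have hsum := Finset.sum_le_sum fun m (_ : m ∈ Finset.univ) =>
    Finset.sum_le_sum fun y (_ : y ∈ Finset.univ) => hterm m y
  have hone : ∑ m, ∑ y, u m * wn m y = 1 := by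
    simp only [← Finset.mul_sum, hwn1, mul_one, hu.2]
  have hR : ∑ m, ∑ y, u m * (Q y * (M : ℝ) ^ φ y m / 2) ≤ 1 := by
    rw [Finset.sum_comm, ← hQ1]
    refine Finset.sum_le_sum fun y _ => ?_
    have hb : ∀ m, (M : ℝ) ^ φ y m ≤ 1 + φ y m * (M - 1) := by
      intro m
      have h1 : φ y m ≤ 1 := (Finset.single_le_sum (f := fun m => φ y m)
        (fun m _ => hφ0 y m) (Finset.mem_univ m)).trans (hφ1 y)
      have := rpow_one_add_le_one_add_mul_self (s := (M : ℝ) - 1) (by linarith) (hφ0 y m) h1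
      rwa [add_sub_cancel] at this
    have hb' : ∑ m, (M : ℝ) ^ φ y m ≤ 2 * M := by
      calc ∑ m, (M : ℝ) ^ φ y m ≤ ∑ m, (1 + φ y m * (M - 1)) := Finset.sum_le_sum fun m _ => hb m
        _ = M + (∑ m, φ y m) * (M - 1) := by
          rw [Finset.sum_add_distrib, Finset.sum_mul]; simp
        _ ≤ 2 * M := by nlinarith [hφ1 y]
    calc ∑ m, u m * (Q y * (M : ℝ) ^ φ y m / 2)
        = (M : ℝ)⁻¹ * Q y / 2 * ∑ m, (M : ℝ) ^ φ y m := by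
          rw [Finset.mul_sum]
          exact Finset.sum_congr rfl fun m _ => by simp only [hu_def]; ring
      _ ≤ (M : ℝ)⁻¹ * Q y / 2 * (2 * M) :=
          mul_le_mul_of_nonneg_left hb' (by have := hQ0 y; positivity)
      _ = Q y := by field_simp
  have hDsum : ∑ m, ∑ y, u m * wn m y * D m y ≤ n * C := by
    have h1 : ∀ m, ∑ y, u m * wn m y * D m y
        = ∑ i, ∑ b, u m * wi i m b * Real.log (densityRatio u (wi i) m b) := by
      intro m
      simp only [hD, Finset.mul_sum]
      rw [Finset.sum_comm]
      refine Finset.sum_congr rfl fun i _ => ?_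
      have := sum_pi_prod_mul (P := fun i => wi i m) (fun i => (hw _).2) i
        fun b => Real.log (densityRatio u (wi i) m b)
      simp only [mul_assoc, ← Finset.mul_sum]
      rw [← this]
    simp only [h1]
    rw [Finset.sum_comm]
    calc _ = ∑ i, mutInfoNat u (wi i) :=
          Finset.sum_congr rfl fun i _ => (mutInfoNat_eq_sum hu.1 (hwi0 i)).symm
      _ ≤ ∑ _i : Fin n, C := Finset.sum_le_sum fun i _ => mutInfoNat_comp_le hu (fun m => f m i) hC
      _ = n * C := by simp
  simp only [Finset.sum_sub_distrib, Finset.sum_add_distrib, ← Finset.sum_mul, hone] at hsum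
  have hfin : (M : ℝ)⁻¹ * ∑ m, ∑ y : Fin n → β, (∏ i, w (f m i) (y i)) * φ y m
      = ∑ m, ∑ y, u m * (wn m y * φ y m) := by
    simp only [Finset.mul_sum, hu_def, hwn, hwi]
  rw [hfin]
  linarith

end Converse

section RelayReduction

variable {𝒳 𝒮 𝒴 𝒴₁ : Type} [Fintype 𝒴₁]

/-- The channel from the input and the state to the receiver's output. -/
def margY (W : 𝒳 → 𝒮 → 𝒴 × 𝒴₁ → ℝ) (x : 𝒳) (s : 𝒮) (y : 𝒴) : ℝ := ∑ y1, W x s (y, y1)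

variable [Fintype 𝒴]

lemma isChannel_margY {W : 𝒳 → 𝒮 → 𝒴 × 𝒴₁ → ℝ} (hW : IsChannel W) : IsChannel (margY W) :=
  fun x s => ⟨fun _ => Finset.sum_nonneg fun _ _ => (hW x s).1 _, by
    simp only [margY, ← Fintype.sum_prod_type']
    exact (hW x s).2⟩

lemma RevStronglyDegraded.exists_eq_margY_mul {W : 𝒳 → 𝒮 → 𝒴 × 𝒴₁ → ℝ}
    (hdeg : RevStronglyDegraded W) :
    ∃ V : 𝒴 → 𝒴₁ → ℝ, (∀ y, IsPMF (V y)) ∧ ∀ x s y y1, W x s (y, y1) = margY W x s y * V y y1 := by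
  obtain ⟨WY, V, -, hV, h⟩ := hdeg
  refine ⟨V, hV, fun x s y y1 => ?_⟩
  simp only [margY, h, ← Finset.mul_sum, (hV y).2, mul_one]

variable [Fintype 𝒳] [Fintype 𝒮]

lemma mutInfoNat_nonneg {α β : Type} [Fintype α] [Fintype β] {p : α → ℝ} (hp : IsPMF p)
    {w : α → β → ℝ} (hw : ∀ x, IsPMF (w x)) : 0 ≤ mutInfoNat p w := by
  simpa using sum_log_le_mutInfoNat hp hw (r := fun _ _ => 1) (fun y => by simp [hp.2])
    (fun _ _ => zero_le_one) (fun _ _ _ => zero_lt_one)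

lemma IqXY_eq_mutInfoNat_div {W : 𝒳 → 𝒮 → 𝒴 × 𝒴₁ → ℝ} (hW : IsChannel W) {q : 𝒮 → ℝ}
    (hq : IsPMF q) (p : 𝒳 → ℝ) :
    IqXY W p q = mutInfoNat p (avgChannel (margY W) q) / Real.log 2 := by
  rw [← mutInfo_eq_mutInfoNat_div fun x => (isPMF_avgChannel (isChannel_margY hW) hq x).2]
  rfl

lemma IqXY_nonneg {W : 𝒳 → 𝒮 → 𝒴 × 𝒴₁ → ℝ} (hW : IsChannel W) {q : 𝒮 → ℝ} (hq : IsPMF q)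
    {p : 𝒳 → ℝ} (hp : IsPMF p) : 0 ≤ IqXY W p q := by
  rw [IqXY_eq_mutInfoNat_div hW hq]
  exact div_nonneg (mutInfoNat_nonneg hp (isPMF_avgChannel (isChannel_margY hW) hq))
    (Real.log_nonneg one_le_two)

lemma bddAbove_IqXY {W : 𝒳 → 𝒮 → 𝒴 × 𝒴₁ → ℝ} (hW : IsChannel W) {q : 𝒮 → ℝ} (hq : IsPMF q) :
    BddAbove {v | ∃ p : 𝒳 → ℝ, IsPMF p ∧ v = IqXY W p q} := by
  obtain ⟨B, hB⟩ := (isCompact_stdSimplex ℝ 𝒳).bddAbove_image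
    (f := fun p => mutInfoNat p (avgChannel (margY W) q) / Real.log 2)
    ((continuous_mutInfoNat.comp
      (continuous_id.prodMk continuous_const)).div_const _).continuousOn
  refine ⟨B, ?_⟩
  rintro v ⟨p, hp, rfl⟩
  rw [IqXY_eq_mutInfoNat_div hW hq]
  exact hB ⟨p, hp, rfl⟩

lemma exists_isPMF (α : Type) [Fintype α] [Nonempty α] : ∃ p : α → ℝ, IsPMF p := by
  classical exact ⟨_, single_mem_stdSimplex ℝ (Classical.arbitrary α)⟩

lemma sSup_IqXY_nonneg [Nonempty 𝒳] {W : 𝒳 → 𝒮 → 𝒴 × 𝒴₁ → ℝ} (hW : IsChannel W) {q : 𝒮 → ℝ}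
    (hq : IsPMF q) : 0 ≤ sSup {v | ∃ p : 𝒳 → ℝ, IsPMF p ∧ v = IqXY W p q} := by
  refine Real.sSup_nonneg ?_
  rintro v ⟨p, hp, rfl⟩
  exact IqXY_nonneg hW hq hp

end RelayReduction

section RelayConverse

variable {𝒳 𝒮 𝒴 𝒴₁ : Type} [Fintype 𝒳] [Fintype 𝒮] [Fintype 𝒴] [Fintype 𝒴₁]

/-- Under i.i.d. states the relay link of a reversely strongly degraded channel amounts to local
randomization at the decoder, so the single-letter converse applies. -/
lemma one_sub_errJoint_mul_log_le {W : 𝒳 → 𝒮 → 𝒴 × 𝒴₁ → ℝ} (hW : IsChannel W)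
    (hdeg : RevStronglyDegraded W) {q : 𝒮 → ℝ} (hq : IsPMF q) {B : ℝ}
    (hB : ∀ p, IsPMF p → mutInfoNat p (avgChannel (margY W) q) ≤ B) {n M L : ℕ} (hM : 1 ≤ M)
    (C : PCode 𝒳 𝒴 𝒴₁ n M L) :
    (1 - C.errJoint W fun s => ∏ i, q (s i)) * Real.log M ≤ Real.log 2 + n * B := by
  obtain ⟨V, hV, hWV⟩ := hdeg.exists_eq_margY_mul
  have hw := isPMF_avgChannel (isChannel_margY hW) hq
  set w := avgChannel (margY W) q with hwdef
  set φ : (Fin n → 𝒴) → Fin M → ℝ := fun y m =>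
    ∑ y1 : Fin n → 𝒴₁, if C.g (y, C.f1 y1) = m then ∏ i, V (y i) (y1 i) else 0 with hφ
  have hVn : ∀ y : Fin n → 𝒴, ∑ y1 : Fin n → 𝒴₁, ∏ i, V (y i) (y1 i) = 1 := fun y =>
    sum_pi_prod_eq_one fun i => (hV (y i)).2
  have hφ0 : ∀ y m, 0 ≤ φ y m := fun y m => Finset.sum_nonneg fun y1 _ => by
    split_ifs
    exacts [Finset.prod_nonneg fun i _ => (hV _).1 _, le_rfl]
  have hφ1 : ∀ y, ∑ m, φ y m ≤ 1 := fun y => by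
    simp only [hφ]
    rw [Finset.sum_comm]
    simp [hVn]
  have havg : ∀ (m : Fin M) (y : Fin n → 𝒴) (y1 : Fin n → 𝒴₁),
      ∑ s : Fin n → 𝒮, (∏ i, q (s i)) * ∏ i, W (C.f m i) (s i) (y i, y1 i)
        = (∏ i, w (C.f m i) (y i)) * ∏ i, V (y i) (y1 i) := by
    intro m y y1
    simp only [← Finset.prod_mul_distrib]
    rw [sum_pi_prod fun i s => q s * W (C.f m i) s (y i, y1 i)]
    refine Finset.prod_congr rfl fun i _ => ?_
    simp only [hwdef, avgChannel, hWV, Finset.sum_mul, mul_assoc]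
  have herr : (C.errJoint W fun s => ∏ i, q (s i)) = (M : ℝ)⁻¹ * ∑ m, ∑ y : Fin n → 𝒴,
      ∑ y1 : Fin n → 𝒴₁, if C.g (y, C.f1 y1) = m then 0
        else (∏ i, w (C.f m i) (y i)) * ∏ i, V (y i) (y1 i) := by
    simp only [PCode.errJoint, PCode.errGiven, Finset.mul_sum]
    rw [Finset.sum_comm]
    refine Finset.sum_congr rfl fun m _ => ?_
    rw [Finset.sum_comm]
    refine Finset.sum_congr rfl fun y _ => ?_
    rw [Finset.sum_comm]
    refine Finset.sum_congr rfl fun y1 _ => ?_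
    split_ifs
    · simp
    · rw [← havg, Finset.mul_sum]
      exact Finset.sum_congr rfl fun s _ => by ring
  have hM0 : (M : ℝ) ≠ 0 := by positivity
  have htot : (M : ℝ)⁻¹ * ∑ m, ∑ y : Fin n → 𝒴, (∏ i, w (C.f m i) (y i)) * φ y m
      = 1 - C.errJoint W fun s => ∏ i, q (s i) := by
    rw [herr, eq_sub_iff_add_eq, ← mul_add, ← Finset.sum_add_distrib]
    have : ∀ m : Fin M, (∑ y : Fin n → 𝒴, (∏ i, w (C.f m i) (y i)) * φ y m)
        + (∑ y : Fin n → 𝒴, ∑ y1 : Fin n → 𝒴₁, if C.g (y, C.f1 y1) = m then 0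
          else (∏ i, w (C.f m i) (y i)) * ∏ i, V (y i) (y1 i)) = 1 := by
      intro m
      rw [← Finset.sum_add_distrib, ← sum_pi_prod_eq_one fun i => (hw (C.f m i)).2]
      refine Finset.sum_congr rfl fun y _ => ?_
      conv_rhs => rw [← mul_one (∏ i, w (C.f m i) (y i)), ← hVn y]
      simp only [hφ, Finset.mul_sum]
      rw [← Finset.sum_add_distrib]
      refine Finset.sum_congr rfl fun y1 _ => ?_
      split_ifs <;> simp
    simp [this, hM0]
  rw [← htot]
  exact success_mul_log_le hw hB hM C.f hφ0 hφ1

lemma exists_le_of_tsum_le {J : Type} (π : PMF J) {a : J → ℝ} {ε : ℝ} (hε : 0 < ε)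
    (h : ∑' j, π j * ENNReal.ofReal (a j) ≤ ENNReal.ofReal ε) : ∃ j, a j ≤ 2 * ε := by
  by_contra! hcon
  have h2 : ENNReal.ofReal (2 * ε) ≤ ENNReal.ofReal ε := by
    calc ENNReal.ofReal (2 * ε) = ∑' j, π j * ENNReal.ofReal (2 * ε) := by
          rw [ENNReal.tsum_mul_right, π.tsum_coe, one_mul]
      _ ≤ ∑' j, π j * ENNReal.ofReal (a j) :=
          ENNReal.tsum_le_tsum fun j => by gcongr; exact (hcon j).le
      _ ≤ _ := h
  rw [ENNReal.ofReal_le_ofReal_iff hε.le] at h2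
  linarith

lemma AVRCRandAchievable.le_sSup_IqXY [Nonempty 𝒳] {W : 𝒳 → 𝒮 → 𝒴 × 𝒴₁ → ℝ} (hW : IsChannel W)
    (hdeg : RevStronglyDegraded W) {C1 R : ℝ} (hR : AVRCRandAchievable W C1 R) {q : 𝒮 → ℝ}
    (hq : IsPMF q) : R ≤ sSup {v | ∃ p : 𝒳 → ℝ, IsPMF p ∧ v = IqXY W p q} := by
  set c := sSup {v | ∃ p : 𝒳 → ℝ, IsPMF p ∧ v = IqXY W p q} with hc
  have hlog2 : 0 < Real.log 2 := Real.log_pos one_lt_two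
  rcases le_or_gt R 0 with hR0 | hR0
  · exact hR0.trans (sSup_IqXY_nonneg hW hq)
  have hB : ∀ p, IsPMF p → mutInfoNat p (avgChannel (margY W) q) ≤ c * Real.log 2 := by
    intro p hp
    rw [← div_le_iff₀ hlog2, ← IqXY_eq_mutInfoNat_div hW hq]
    exact le_csSup (bddAbove_IqXY hW hq) ⟨p, hp, rfl⟩
  have key : ∀ ε ∈ Set.Ioo (0 : ℝ) (1 / 2), (1 - 2 * ε) * R ≤ c := by
    rintro ε ⟨hε0, hε1⟩
    obtain ⟨N, hN⟩ := hR ε hε0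
    have hbound : ∀ n ≥ N, (n : ℝ) * (((1 - 2 * ε) * R - c) * Real.log 2) ≤ Real.log 2 := by
      intro n hn
      obtain ⟨M, L, hM, -, J, π, Cs, hCs⟩ := hN n hn
      obtain ⟨j, hj⟩ := exists_le_of_tsum_le π hε0 (hCs _ (isPMF_pi fun _ => hq))
      have hpow : (0 : ℝ) < 2 ^ ((n : ℝ) * R) := Real.rpow_pos_of_pos two_pos _
      have hM1 : 1 ≤ M := by
        have : (0 : ℝ) < M := hpow.trans_le hM
        exact_mod_cast this
      have hlogM : n * R * Real.log 2 ≤ Real.log M := by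
        rw [← Real.log_rpow two_pos]
        exact Real.log_le_log hpow hM
      have h1 := one_sub_errJoint_mul_log_le hW hdeg hq hB hM1 (Cs j)
      have h2 : (1 - 2 * ε) * (n * R * Real.log 2)
          ≤ (1 - (Cs j).errJoint W fun s => ∏ i, q (s i)) * Real.log M := by
        have : 0 ≤ n * R * Real.log 2 := by positivity
        exact mul_le_mul (by linarith) hlogM this (by linarith)
      linarith
    by_contra! hcon
    have hpos : 0 < ((1 - 2 * ε) * R - c) * Real.log 2 := mul_pos (sub_pos.2 hcon) hlog2
    obtain ⟨k, hk⟩ := exists_nat_gt (Real.log 2 / (((1 - 2 * ε) * R - c) * Real.log 2))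
    rw [div_lt_iff₀ hpos] at hk
    have hle : (k : ℝ) ≤ (max k N : ℕ) := by exact_mod_cast le_max_left k N
    have := hbound (max k N) (le_max_right _ _)
    have := mul_le_mul_of_nonneg_right hle hpos.le
    linarith
  by_contra! hcon
  have hc0 := sSup_IqXY_nonneg hW hq
  have := key ((R - c) / (4 * R)) ⟨by have := sub_pos.2 hcon; positivity, by
    rw [div_lt_iff₀ (by positivity)]; linarith⟩
  have h2 : (1 - 2 * ((R - c) / (4 * R))) * R = R - (R - c) / 2 := by field_simp; ring
  linarith

end RelayConverse

section RobustInput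

variable {α β σ : Type} [Fintype α] [Fintype β] [Fintype σ]

lemma sum_mul_log_le_card {p : α → ℝ} {w r : α → β → ℝ} (hp : IsPMF p) (hw : ∀ x, IsPMF (w x))
    (hr0 : ∀ x y, 0 ≤ r x y) (hr1 : ∀ y, ∑ x, p x * r x y ≤ 1) :
    ∑ x, ∑ y, p x * w x y * Real.log (r x y) ≤ Fintype.card α := by
  have h : ∀ x y, p x * w x y * Real.log (r x y) ≤ w x y := by
    intro x y
    have h1 : p x * r x y ≤ 1 := (Finset.single_le_sum
      (f := fun x => p x * r x y) (fun x _ => mul_nonneg (hp.1 x) (hr0 x y))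
      (Finset.mem_univ x)).trans (hr1 y)
    have h2 : p x * Real.log (r x y) ≤ 1 :=
      (mul_le_mul_of_nonneg_left (Real.log_le_self (hr0 x y)) (hp.1 x)).trans h1
    calc p x * w x y * Real.log (r x y) = w x y * (p x * Real.log (r x y)) := by ring
      _ ≤ w x y * 1 := mul_le_mul_of_nonneg_left h2 ((hw x).1 y)
      _ = w x y := mul_one _
  calc ∑ x, ∑ y, p x * w x y * Real.log (r x y) ≤ ∑ x, ∑ y, w x y :=
        Finset.sum_le_sum fun x _ => Finset.sum_le_sum fun y _ => h x y
    _ = Fintype.card α := by simp [(hw _).2]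

/-- A single input distribution and a single likelihood ratio serve all states at once. -/
lemma exists_robust_input [Nonempty α] [Nonempty σ] {K : α → σ → β → ℝ} (hK : IsChannel K)
    {γ v : ℝ} (hγ0 : 0 ≤ γ) (hγv : γ < v)
    (hv : ∀ q, IsPMF q → ∀ B, (∀ p, IsPMF p → mutInfoNat p (avgChannel K q) ≤ B) → v ≤ B) :
    ∃ (p : α → ℝ) (r : α → β → ℝ), IsPMF p ∧ (∀ x y, 0 ≤ r x y) ∧
      (∀ y, ∑ x, p x * r x y ≤ 1) ∧ (∀ x s y, 0 < p x * K x s y → 0 < r x y) ∧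
      ∀ s, γ < ∑ x, ∑ y, p x * K x s y * Real.log (r x y) := by
  obtain ⟨u, hu⟩ : ∃ u : σ → ℝ, IsPMF u ∧ ∀ s, 0 < u s := by
    refine ⟨fun _ => (Fintype.card σ : ℝ)⁻¹, ⟨fun _ => by positivity, ?_⟩, fun _ => ?_⟩
    · simp
    · have : 0 < Fintype.card σ := Fintype.card_pos
      positivity
  set N : ℝ := (Fintype.card α : ℝ)
  have hN : 0 ≤ N := Nat.cast_nonneg _
  obtain ⟨η, hη0, hη1, hηv⟩ : ∃ η : ℝ, 0 < η ∧ η < 1 ∧ η * N < v - γ := by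
    have hd : 0 < v - γ := sub_pos.2 hγv
    refine ⟨(v - γ) / (v - γ + N + 1), by positivity, ?_, ?_⟩
    · rw [div_lt_one (by positivity)]
      linarith
    · rw [div_mul_eq_mul_div, div_lt_iff₀ (by positivity)]
      nlinarith
  have hη1' : 0 < 1 - η := sub_pos.2 hη1
  have hU := isPMF_avgChannel hK hu.1
  have hU_pos : ∀ x s y, 0 < K x s y → 0 < avgChannel K u x y := fun x s y h =>
    Finset.sum_pos' (fun s _ => mul_nonneg (hu.1.1 s) ((hK x s).1 y))
      ⟨s, Finset.mem_univ _, mul_pos (hu.2 s) h⟩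
  set K' : α → σ → β → ℝ := fun x s y => (1 - η) * K x s y + η * avgChannel K u x y with hK'def
  have hK' : IsChannel K' := fun x s =>
    ⟨fun y => add_nonneg (mul_nonneg hη1'.le ((hK x s).1 y)) (mul_nonneg hη0.le ((hU x).1 y)), by
      simp only [hK'def, Finset.sum_add_distrib, ← Finset.mul_sum, (hK x s).2, (hU x).2]
      ring⟩
  have hsupp : ∀ x s s' y, 0 < K' x s y → 0 < K' x s' y := by
    intro x s s' y h
    have hUy : 0 < avgChannel K u x y := by
      rcases ((hK x s).1 y).eq_or_lt with h0 | h0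
      · simp only [hK'def, ← h0, mul_zero, zero_add] at h
        exact (pos_iff_pos_of_mul_pos h).1 hη0
      · exact hU_pos x s y h0
    exact add_pos_of_nonneg_of_pos (mul_nonneg hη1'.le ((hK x s').1 y)) (mul_pos hη0 hUy)
  obtain ⟨p, q, hp, hq, hmax, hmin⟩ := exists_saddle hK'
  have hmix : avgChannel K' q = avgChannel K ((1 - η) • q + η • u) := by
    funext x y
    rw [avgChannel_combo]
    simp only [avgChannel, hK'def, mul_add, Finset.sum_add_distrib]
    congr 1
    · rw [Finset.mul_sum]
      exact Finset.sum_congr rfl fun s _ => by ring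
    · rw [← Finset.sum_mul, hq.2, one_mul]
  have hmixPMF : IsPMF ((1 - η) • q + η • u) :=
    convex_stdSimplex ℝ σ hq hu.1 hη1'.le hη0.le (by ring)
  have hvp : v ≤ mutInfoNat p (avgChannel K' q) :=
    hv _ hmixPMF _ fun p' hp' => hmix ▸ hmax p' hp'
  have hw := isPMF_avgChannel hK' hq
  have hr0 : ∀ x y, 0 ≤ densityRatio p (avgChannel K' q) x y :=
    densityRatio_nonneg hp.1 fun x => (hw x).1
  have hr1 := sum_mul_densityRatio_le_one p (avgChannel K' q)
  refine ⟨p, densityRatio p (avgChannel K' q), hp, hr0, hr1, fun x s y h => ?_, fun s => ?_⟩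
  · have hpx : 0 < p x := (pos_iff_pos_of_mul_pos h).2 ((hK x s).1 y |>.lt_of_ne fun h0 => by
      simp [← h0] at h)
    have hKx : 0 < K x s y := (pos_iff_pos_of_mul_pos h).1 hpx
    exact densityRatio_pos hp.1 (fun x => (hw x).1) (mul_pos hpx (avgChannel_pos hK' hq hsupp
      (add_pos_of_pos_of_nonneg (mul_pos hη1' hKx) (mul_nonneg hη0.le ((hU x).1 y)) :
        0 < K' x s y)))
  · have h1 := hvp.trans (mutInfoNat_le_sum_log_of_isMinOn hK' hsupp hp hq hmin s)
    have h2 := sum_mul_log_le_card hp hU hr0 hr1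
    rw [sum_combo_mul_log p _ (fun x y => K x s y) (avgChannel K u) _ (1 - η) η
      fun x y => rfl] at h1
    have h3 := mul_le_mul_of_nonneg_left h2 hη0.le
    set X := ∑ x, ∑ y, p x * K x s y * Real.log (densityRatio p (avgChannel K' q) x y)
    have h4 : γ < (1 - η) * X := by linarith
    have h5 : 0 < X := (pos_iff_pos_of_mul_pos (hγ0.trans_lt h4)).1 hη1'
    nlinarith

end RobustInput

section RelayAchievability

variable {𝒳 𝒮 𝒴 𝒴₁ : Type} [Fintype 𝒴] [Fintype 𝒴₁]

lemma exists_pmf_tsum_eq {J : Type} [Fintype J] {P : J → ℝ} (hP : IsPMF P) :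
    ∃ π : PMF J, ∀ a : J → ℝ, (∀ j, 0 ≤ a j) →
      ∑' j, π j * ENNReal.ofReal (a j) = ENNReal.ofReal (∑ j, P j * a j) := by
  refine ⟨PMF.ofFintype (fun j => ENNReal.ofReal (P j)) ?_, fun a ha => ?_⟩
  · rw [← ENNReal.ofReal_sum_of_nonneg fun j _ => hP.1 j, hP.2, ENNReal.ofReal_one]
  · rw [tsum_fintype, ENNReal.ofReal_sum_of_nonneg fun j _ => mul_nonneg (hP.1 j) (ha j)]
    exact Finset.sum_congr rfl fun j _ => by rw [PMF.ofFintype_apply, ENNReal.ofReal_mul (hP.1 j)]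

lemma PCode.errGiven_eq_of_g_eq {n M L : ℕ} (C : PCode 𝒳 𝒴 𝒴₁ n M L) (W : 𝒳 → 𝒮 → 𝒴 × 𝒴₁ → ℝ)
    {d : (Fin n → 𝒴) → Fin M} (hd : ∀ z, C.g z = d z.1) (s : Fin n → 𝒮) :
    C.errGiven W s = (M : ℝ)⁻¹ * ∑ m : Fin M, ∑ y : Fin n → 𝒴,
      if d y = m then 0 else ∏ i, margY W (C.f m i) (s i) (y i) := by
  simp only [PCode.errGiven, hd]
  congr 1
  refine Finset.sum_congr rfl fun m _ => Finset.sum_congr rfl fun y _ => ?_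
  split_ifs
  · simp
  · exact sum_pi_prod fun i y1 => W (C.f m i) (s i) (y i, y1)

lemma linkOK_one {n : ℕ} {C1 : ℝ} (hC1 : 0 ≤ C1) : LinkOK n 1 C1 :=
  ⟨le_rfl, by simpa using Real.one_le_rpow one_le_two (by positivity : 0 ≤ (n : ℝ) * C1)⟩

lemma natCeil_rpow_mul_exp_le {R : ℝ} (γ : ℝ) (n : ℕ) :
    (⌈(2 : ℝ) ^ ((n : ℝ) * R)⌉₊ : ℝ) * Real.exp (-(n * γ))
      ≤ Real.exp (-(γ - R * Real.log 2)) ^ n + Real.exp (-γ) ^ n := by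
  have h1 : (⌈(2 : ℝ) ^ ((n : ℝ) * R)⌉₊ : ℝ) ≤ (2 : ℝ) ^ ((n : ℝ) * R) + 1 :=
    (Nat.ceil_lt_add_one (Real.rpow_pos_of_pos two_pos _).le).le
  have h2 : (2 : ℝ) ^ ((n : ℝ) * R) = Real.exp (n * (R * Real.log 2)) := by
    rw [Real.rpow_def_of_pos two_pos]
    congr 1
    ring
  calc _ ≤ ((2 : ℝ) ^ ((n : ℝ) * R) + 1) * Real.exp (-(n * γ)) := by gcongr
    _ = _ := by
      rw [h2, add_mul, one_mul, ← Real.exp_add, ← Real.exp_nat_mul, ← Real.exp_nat_mul]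
      congr 2 <;> ring

variable [Fintype 𝒮]

lemma PCode.errJoint_nonneg {n M L : ℕ} (C : PCode 𝒳 𝒴 𝒴₁ n M L) {W : 𝒳 → 𝒮 → 𝒴 × 𝒴₁ → ℝ}
    (hW : IsChannel W) {qn : (Fin n → 𝒮) → ℝ} (hqn : IsPMF qn) : 0 ≤ C.errJoint W qn :=
  Finset.sum_nonneg fun s _ => mul_nonneg (hqn.1 s) <| mul_nonneg (by positivity) <|
    Finset.sum_nonneg fun m _ => Finset.sum_nonneg fun y _ => Finset.sum_nonneg fun y1 _ => by
      split_ifs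
      exacts [le_rfl, Finset.prod_nonneg fun i _ => (hW _ _).1 _]

lemma avrcRandAchievable_zero [Nonempty 𝒳] (W : 𝒳 → 𝒮 → 𝒴 × 𝒴₁ → ℝ) {C1 : ℝ} (hC1 : 0 ≤ C1) :
    AVRCRandAchievable W C1 0 := by
  intro ε hε
  refine ⟨0, fun n _ => ⟨1, 1, by simp, linkOK_one hC1, Unit, PMF.pure (), fun _ =>
    ⟨fun _ _ => Classical.arbitrary 𝒳, fun _ => 0, fun _ => 0⟩, fun qn _ => ?_⟩⟩
  simp [PCode.errJoint, PCode.errGiven]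

lemma avrcRandCapacity_of_isEmpty [Nonempty 𝒳] [IsEmpty 𝒮] (W : 𝒳 → 𝒮 → 𝒴 × 𝒴₁ → ℝ) {C1 : ℝ}
    (hC1 : 0 ≤ C1) : AVRCRandCapacity W C1 = 0 := by
  have h : {R | AVRCRandAchievable W C1 R} = Set.univ := by
    refine Set.eq_univ_of_forall fun R ε _ => ⟨1, fun n hn => ?_⟩
    refine ⟨⌈(2 : ℝ) ^ ((n : ℝ) * R)⌉₊, 1, Nat.le_ceil _, linkOK_one hC1, Unit, PMF.pure (), fun _ =>
      ⟨fun _ _ => Classical.arbitrary 𝒳, fun _ => 0, fun _ =>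
        ⟨0, Nat.ceil_pos.2 (Real.rpow_pos_of_pos two_pos _)⟩⟩, fun qn hqn => ?_⟩
    have : Nonempty (Fin n) := ⟨⟨0, hn⟩⟩
    have := hqn.2
    simp at this
  rw [AVRCRandCapacity, h, Real.sSup_univ]

variable [Fintype 𝒳]

/-- The expected error of i.i.d. random coding with a threshold decoder ignoring the relay. -/
lemma exists_random_code {W : 𝒳 → 𝒮 → 𝒴 × 𝒴₁ → ℝ} (hW : IsChannel W) {p : 𝒳 → ℝ}
    {r : 𝒳 → 𝒴 → ℝ} (hp : IsPMF p) (hr0 : ∀ x y, 0 ≤ r x y) (hr1 : ∀ y, ∑ x, p x * r x y ≤ 1)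
    (hr : ∀ x s y, 0 < p x * margY W x s y → 0 < r x y) {l γ ρ : ℝ} (hl : 0 < l)
    (hρ : ∀ s, ∑ x, ∑ y, p x * margY W x s y * Real.exp (l * (γ - Real.log (r x y))) ≤ ρ)
    {M n : ℕ} (m₀ : Fin M) :
    ∃ (J : Type) (π : PMF J) (Cs : J → PCode 𝒳 𝒴 𝒴₁ n M 1),
      ∀ qn : (Fin n → 𝒮) → ℝ, IsPMF qn → (∑' j, π j * ENNReal.ofReal ((Cs j).errJoint W qn))
        ≤ ENNReal.ofReal (ρ ^ n + M * Real.exp (-(n * γ))) := by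
  set P : (Fin M → Fin n → 𝒳) → ℝ := fun c => ∏ k, ∏ i, p (c k i)
  obtain ⟨π, hπ⟩ := exists_pmf_tsum_eq (P := P) (isPMF_pi fun _ => isPMF_pi fun _ => hp)
  set Cs : (Fin M → Fin n → 𝒳) → PCode 𝒳 𝒴 𝒴₁ n M 1 := fun c =>
    ⟨c, fun _ => 0, fun z => thresholdDecoder r (Real.exp (n * γ)) m₀ c z.1⟩
  refine ⟨_, π, Cs, fun qn hqn => ?_⟩
  rw [hπ _ fun c => (Cs c).errJoint_nonneg hW hqn]
  refine ENNReal.ofReal_le_ofReal ?_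
  set b := ρ ^ n + M * Real.exp (-(n * γ))
  have hM0 : (M : ℝ) ≠ 0 := by
    have := m₀.pos
    positivity
  have hgiven : ∀ s, ∑ c, P c * (Cs c).errGiven W s ≤ b := by
    intro s
    calc ∑ c, P c * (Cs c).errGiven W s
        = (M : ℝ)⁻¹ * ∑ m : Fin M, ∑ c, P c * ∑ y : Fin n → 𝒴,
            (if thresholdDecoder r (Real.exp (n * γ)) m₀ c y = m then 0
              else ∏ i, margY W (c m i) (s i) (y i)) := by
          rw [Finset.sum_comm, Finset.mul_sum]
          refine Finset.sum_congr rfl fun c _ => ?_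
          rw [(Cs c).errGiven_eq_of_g_eq W
            (d := thresholdDecoder r (Real.exp (n * γ)) m₀ c) (fun _ => rfl), ← Finset.mul_sum]
          ring
      _ ≤ (M : ℝ)⁻¹ * ∑ m : Fin M, b := by
          gcongr with m
          exact sum_randomCodebook_error_le hp (isChannel_margY hW) hr0 hr1 hr hl hρ m₀ m s
      _ = b := by
          simp [hM0]
  calc ∑ c, P c * (Cs c).errJoint W qn = ∑ s, qn s * ∑ c, P c * (Cs c).errGiven W s := by
        simp only [PCode.errJoint, Finset.mul_sum]
        rw [Finset.sum_comm]
        exact Finset.sum_congr rfl fun s _ => Finset.sum_congr rfl fun c _ => by ring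
    _ ≤ ∑ s, qn s * b :=
        Finset.sum_le_sum fun s _ => mul_le_mul_of_nonneg_left (hgiven s) (hqn.1 s)
    _ = b := by rw [← Finset.sum_mul, hqn.2, one_mul]

lemma avrcRandAchievable_of_lt [Nonempty 𝒳] [Nonempty 𝒮] {W : 𝒳 → 𝒮 → 𝒴 × 𝒴₁ → ℝ}
    (hW : IsChannel W) {C1 : ℝ} (hC1 : 0 ≤ C1) {R v : ℝ} (hR : 0 < R) (hRv : R < v)
    (hv : ∀ q, IsPMF q → ∀ B, (∀ p : 𝒳 → ℝ, IsPMF p → IqXY W p q ≤ B) → v ≤ B) :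
    AVRCRandAchievable W C1 R := by
  have hlog2 : 0 < Real.log 2 := Real.log_pos one_lt_two
  obtain ⟨γ, hγR, hγv⟩ := exists_between (mul_lt_mul_of_pos_right hRv hlog2)
  obtain ⟨γ', hγ, hγ'v⟩ := exists_between hγv
  have hγ0 : 0 < γ := (mul_pos hR hlog2).trans hγR
  have hv' : ∀ q, IsPMF q → ∀ B, (∀ p, IsPMF p → mutInfoNat p (avgChannel (margY W) q) ≤ B) →
      v * Real.log 2 ≤ B := by
    intro q hq B hB
    rw [← le_div_iff₀ hlog2]
    refine hv q hq _ fun p hp => ?_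
    rw [IqXY_eq_mutInfoNat_div hW hq]
    exact div_le_div_of_nonneg_right (hB p hp) hlog2.le
  obtain ⟨p, r, hp, hr0, hr1, hr, hs⟩ :=
    exists_robust_input (isChannel_margY hW) (hγ0.trans hγ).le hγ'v hv'
  obtain ⟨l, ρ, hl, hρ0, hρ1, hρ⟩ := exists_chernoff_bound hp (isChannel_margY hW)
    (fun x y => Real.log (r x y)) hγ fun s => (hs s).le
  have hlim : Filter.Tendsto (fun n : ℕ => ρ ^ n
      + (Real.exp (-(γ - R * Real.log 2)) ^ n + Real.exp (-γ) ^ n)) Filter.atTop (nhds 0) := by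
    have hexp : ∀ a : ℝ, 0 < a →
        Filter.Tendsto (fun n : ℕ => Real.exp (-a) ^ n) Filter.atTop (nhds 0) := fun a ha =>
      tendsto_pow_atTop_nhds_zero_of_lt_one (Real.exp_pos _).le
        (Real.exp_lt_one_iff.2 (neg_lt_zero.2 ha))
    simpa using (tendsto_pow_atTop_nhds_zero_of_lt_one hρ0 hρ1).add
      ((hexp _ (sub_pos.2 hγR)).add (hexp γ hγ0))
  intro ε hε
  obtain ⟨N, hN⟩ := Filter.eventually_atTop.1 (hlim.eventually_lt_const hε)
  refine ⟨N, fun n hn => ⟨⌈(2 : ℝ) ^ ((n : ℝ) * R)⌉₊, 1, Nat.le_ceil _, linkOK_one hC1, ?_⟩⟩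
  obtain ⟨J, π, Cs, h⟩ := exists_random_code (n := n) hW hp hr0 hr1 hr hl hρ
    ⟨0, Nat.ceil_pos.2 (Real.rpow_pos_of_pos two_pos ((n : ℝ) * R))⟩
  refine ⟨J, π, Cs, fun qn hqn => (h qn hqn).trans (ENNReal.ofReal_le_ofReal ?_)⟩
  have := natCeil_rpow_mul_exp_le (R := R) γ n
  have := hN n hn
  linarith

end RelayAchievability

/-- For a reversely strongly degraded primitive AVRC, the random code capacity is
`min_{q(s)} max_{p(x)} I_q(X;Y)`. -/
theorem avrc_revStronglyDegraded_randomCapacity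
    {𝒳 𝒮 𝒴 𝒴₁ : Type} [Fintype 𝒳] [Fintype 𝒮] [Fintype 𝒴] [Fintype 𝒴₁] [Nonempty 𝒳]
    (W : 𝒳 → 𝒮 → 𝒴 × 𝒴₁ → ℝ) (hW : IsChannel W)
    (C1 : ℝ) (hC1 : 0 ≤ C1)
    (hdeg : RevStronglyDegraded W) :
    AVRCRandCapacity W C1
      = sInf {r | ∃ q : 𝒮 → ℝ, IsPMF q ∧
          r = sSup {v | ∃ p : 𝒳 → ℝ, IsPMF p ∧ v = IqXY W p q}} := by
  rcases isEmpty_or_nonempty 𝒮 with h𝒮 | h𝒮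
  · rw [avrcRandCapacity_of_isEmpty W hC1]
    simp [IsPMF]
  have hbdd : BddBelow {r | ∃ q : 𝒮 → ℝ, IsPMF q ∧
      r = sSup {v | ∃ p : 𝒳 → ℝ, IsPMF p ∧ v = IqXY W p q}} := by
    refine ⟨0, ?_⟩
    rintro r ⟨q, hq, rfl⟩
    exact sSup_IqXY_nonneg hW hq
  obtain ⟨q₀, hq₀⟩ := exists_isPMF 𝒮
  have hzero := avrcRandAchievable_zero W hC1
  have hachBdd : BddAbove {R | AVRCRandAchievable W C1 R} :=
    ⟨_, fun R hR => hR.le_sSup_IqXY hW hdeg hq₀⟩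
  refine le_antisymm (csSup_le ⟨0, hzero⟩ fun R hR => le_csInf ⟨_, q₀, hq₀, rfl⟩ ?_)
    (le_of_forall_lt_imp_le_of_dense fun R hR => ?_)
  · rintro r ⟨q, hq, rfl⟩
    exact hR.le_sSup_IqXY hW hdeg hq
  · rcases le_or_gt R 0 with hR0 | hR0
    · exact hR0.trans (le_csSup hachBdd hzero)
    · refine le_csSup hachBdd (avrcRandAchievable_of_lt hW hC1 hR0 hR fun q hq B hB => ?_)
      refine (csInf_le hbdd ⟨q, hq, rfl⟩).trans ?_
      obtain ⟨p₀, hp₀⟩ := exists_isPMF 𝒳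
      refine csSup_le ⟨_, p₀, hp₀, rfl⟩ ?_
      rintro v ⟨p, hp, rfl⟩
      exact hB p hp
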